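/- arXiv:2211.02173 — 2 statements merged into one kernel-verified Lean document; each statement's English description precedes it below -/
import Mathlib

section
/- Assume additionally that X is connected. Then Σ₁ = Σ₀ ⋆ S. -/
open MeasureTheory Topology
open scoped Pointwise ENNReal

/-- The star operation on compact subsets of `ℝ`: `A ⋆ B = A + ch(B)` if
`diam(A) ≥ diam(B)`, and `A ⋆ B = ch(A) + B` otherwise, where `ch(A) = [inf A, sup A]`
and `diam(A) = sup A - inf A`. -/
noncomputable def starOp (A B : Set ℝ) : Set ℝ :=
  if sSup B - sInf B ≤ sSup A - sInf A then A + Set.Icc (sInf B) (sSup B)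
  else Set.Icc (sInf A) (sSup A) + B

section SelfAdjoint

variable {E : Type*} [NormedAddCommGroup E] [InnerProductSpace ℝ E] [CompleteSpace E]

omit [CompleteSpace E] in
lemma exists_pos_mul_norm_le_of_isUnit {A : E →L[ℝ] E} (hA : IsUnit A) :
    ∃ c > 0, ∀ v, c * ‖v‖ ≤ ‖A v‖ := by
  obtain ⟨U, rfl⟩ := hA
  have hpos : 0 < ‖(↑U⁻¹ : E →L[ℝ] E)‖ + 1 := by positivity
  refine ⟨(‖(↑U⁻¹ : E →L[ℝ] E)‖ + 1)⁻¹, by positivity, fun v => ?_⟩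
  rw [inv_mul_le_iff₀ hpos]
  have h : (↑U⁻¹ : E →L[ℝ] E) ((U : E →L[ℝ] E) v) = v := by
    rw [← mul_apply_eq_comp, Units.inv_mul]; rfl
  calc ‖v‖ = ‖(↑U⁻¹ : E →L[ℝ] E) ((U : E →L[ℝ] E) v)‖ := by rw [h]
    _ ≤ ‖(↑U⁻¹ : E →L[ℝ] E)‖ * ‖(U : E →L[ℝ] E) v‖ := ContinuousLinearMap.le_opNorm _ _
    _ ≤ _ := by gcongr; linarith

lemma IsSelfAdjoint.isUnit_of_mul_norm_le {A : E →L[ℝ] E} (hA : IsSelfAdjoint A) {c : ℝ}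
    (hc : 0 < c) (h : ∀ v, c * ‖v‖ ≤ ‖A v‖) : IsUnit A := by
  rw [ContinuousLinearMap.isUnit_iff_bijective,
    ContinuousLinearMap.bijective_iff_dense_range_and_antilipschitz]
  constructor
  · rw [Submodule.topologicalClosure_eq_top_iff, ContinuousLinearMap.orthogonal_range,
      hA.adjoint_eq, LinearMap.ker_eq_bot']
    intro v hv
    have := h v
    have hv' : A v = 0 := hv
    rw [hv', norm_zero] at this
    exact norm_le_zero_iff.1 (nonpos_of_mul_nonpos_right this hc)
  · refine ⟨⟨c⁻¹, by positivity⟩, A.antilipschitz_of_bound fun v => ?_⟩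
    change ‖v‖ ≤ c⁻¹ * ‖A v‖
    rw [le_inv_mul_iff₀ hc]
    exact h v

lemma IsSelfAdjoint.inner_apply_comm {A : E →L[ℝ] E} (hA : IsSelfAdjoint A) (v w : E) :
    inner ℝ (A v) w = inner ℝ v (A w) :=
  hA.isSymmetric v w

lemma IsSelfAdjoint.exists_mem_spectrum_abs_eq_norm [Nontrivial E] {A : E →L[ℝ] E}
    (hA : IsSelfAdjoint A) : ∃ m ∈ spectrum ℝ A, |m| = ‖A‖ := by
  by_contra! hcon
  have h₁ : IsUnit (algebraMap ℝ (E →L[ℝ] E) ‖A‖ - A) := by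
    by_contra h
    exact hcon ‖A‖ h (abs_norm A)
  have h₂ : IsUnit (algebraMap ℝ (E →L[ℝ] E) (-‖A‖) - A) := by
    by_contra h
    exact hcon (-‖A‖) h (by rw [abs_neg, abs_norm])
  obtain ⟨c, hc, hbound⟩ := exists_pos_mul_norm_le_of_isUnit (h₁.mul h₂)
  set M := ‖A‖ with hM
  have key : ∀ v, c ^ 2 * ‖v‖ ^ 2 + M ^ 2 * ‖A v‖ ^ 2 ≤ M ^ 4 * ‖v‖ ^ 2 := by
    intro v
    have e : (algebraMap ℝ (E →L[ℝ] E) M - A) ((algebraMap ℝ (E →L[ℝ] E) (-M) - A) v)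
        = A (A v) - M ^ 2 • v := by
      simp only [Algebra.algebraMap_eq_smul_one, sub_apply,
        smul_apply, one_apply_eq_self, map_sub, map_smul]
      module
    have h₃ := hbound v
    rw [mul_apply_eq_comp, e] at h₃
    have h₄ : ‖A (A v)‖ ≤ M * ‖A v‖ := A.le_opNorm _
    have h₅ := norm_sub_sq_real (A (A v)) (M ^ 2 • v)
    rw [inner_smul_right, hA.inner_apply_comm (A v) v, real_inner_self_eq_norm_sq, norm_smul, Real.norm_of_nonneg (by positivity)] at h₅
    have h₆ : (c * ‖v‖) ^ 2 ≤ ‖A (A v) - M ^ 2 • v‖ ^ 2 := by gcongr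
    have h₇ : ‖A (A v)‖ ^ 2 ≤ (M * ‖A v‖) ^ 2 := by gcongr
    nlinarith
  rcases (norm_nonneg A).eq_or_lt with h0 | hpos
  · obtain ⟨v, hv⟩ := exists_ne (0 : E)
    have h := key v
    rw [hM, ← h0] at h
    have : 0 < c ^ 2 * ‖v‖ ^ 2 := by positivity
    norm_num at h
    linarith
  · rw [← hM] at hpos
    have hle : M ≤ √(M ^ 2 - c ^ 2 / M ^ 2) := by
      refine A.opNorm_le_bound (Real.sqrt_nonneg _) fun v => ?_
      have h : ‖A v‖ ^ 2 ≤ (M ^ 2 - c ^ 2 / M ^ 2) * ‖v‖ ^ 2 := by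
        have hk := key v
        have : (M ^ 2 - c ^ 2 / M ^ 2) * ‖v‖ ^ 2
            = (M ^ 4 * ‖v‖ ^ 2 - c ^ 2 * ‖v‖ ^ 2) / M ^ 2 := by
          field_simp
        rw [this, le_div_iff₀ (by positivity)]
        linarith
      have h' := Real.abs_le_sqrt h
      rwa [abs_norm, Real.sqrt_mul' _ (by positivity), Real.sqrt_sq (norm_nonneg v)] at h'
    rw [Real.le_sqrt' hpos] at hle
    have : 0 < c ^ 2 / M ^ 2 := by positivity
    linarith

lemma IsSelfAdjoint.sub_algebraMap {A : E →L[ℝ] E} (hA : IsSelfAdjoint A) (t : ℝ) :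
    IsSelfAdjoint (A - algebraMap ℝ (E →L[ℝ] E) t) :=
  hA.sub ((IsSelfAdjoint.all t).algebraMap _)

omit [CompleteSpace E] in
lemma sub_algebraMap_apply (A : E →L[ℝ] E) (t : ℝ) (v : E) :
    (A - algebraMap ℝ (E →L[ℝ] E) t) v = A v - t • v := by
  simp [Algebra.algebraMap_eq_smul_one]

lemma IsSelfAdjoint.notMem_spectrum_of_mul_norm_le {A : E →L[ℝ] E} (hA : IsSelfAdjoint A)
    {c t : ℝ} (hc : 0 < c) (h : ∀ v, c * ‖v‖ ≤ ‖A v - t • v‖) : t ∉ spectrum ℝ A := by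
  rw [spectrum.notMem_iff, ← IsUnit.neg_iff, neg_sub]
  exact (hA.sub_algebraMap t).isUnit_of_mul_norm_le hc fun v => by
    rw [sub_algebraMap_apply]
    exact h v

lemma IsSelfAdjoint.exists_norm_sub_lt_of_mem_spectrum {A : E →L[ℝ] E} (hA : IsSelfAdjoint A)
    {c t : ℝ} (hc : 0 < c) (ht : t ∈ spectrum ℝ A) : ∃ v, ‖A v - t • v‖ < c * ‖v‖ := by
  by_contra! h
  exact hA.notMem_spectrum_of_mul_norm_le hc h ht

omit [CompleteSpace E] in
lemma add_mem_spectrum_of_mem_spectrum_sub {A : E →L[ℝ] E} {m t : ℝ}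
    (hm : m ∈ spectrum ℝ (A - algebraMap ℝ (E →L[ℝ] E) t)) : m + t ∈ spectrum ℝ A := by
  rwa [spectrum.add_mem_iff, neg_add_eq_sub]

lemma IsSelfAdjoint.norm_sub_smul_le [Nontrivial E] {A : E →L[ℝ] E} (hA : IsSelfAdjoint A)
    {r t : ℝ} (h : ∀ m ∈ spectrum ℝ A, |m - t| ≤ r) (v : E) : ‖A v - t • v‖ ≤ r * ‖v‖ := by
  obtain ⟨m, hm, hnorm⟩ := (hA.sub_algebraMap t).exists_mem_spectrum_abs_eq_norm
  have h' := h _ (add_mem_spectrum_of_mem_spectrum_sub hm)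
  rw [add_sub_cancel_right, hnorm] at h'
  rw [← sub_algebraMap_apply]
  exact (ContinuousLinearMap.le_opNorm _ v).trans (by gcongr)

lemma IsSelfAdjoint.mul_norm_le_norm_sub_smul [Nontrivial E] {A : E →L[ℝ] E}
    (hA : IsSelfAdjoint A) {c t : ℝ} (hc : 0 < c) (h : ∀ m ∈ spectrum ℝ A, c ≤ |m - t|) (v : E) :
    c * ‖v‖ ≤ ‖A v - t • v‖ := by
  have hunit : IsUnit (A - algebraMap ℝ (E →L[ℝ] E) t) := by
    by_contra hcon
    have h0 := h _ (add_mem_spectrum_of_mem_spectrum_sub ((spectrum.zero_mem_iff ℝ).2 hcon))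
    simp at h0
    linarith
  obtain ⟨U, hU⟩ := hunit
  have hsa : IsSelfAdjoint (↑U⁻¹ : E →L[ℝ] E) := by
    have h₁ : IsSelfAdjoint (U : E →L[ℝ] E) := hU ▸ hA.sub_algebraMap t
    have h₂ : star U = U := Units.ext h₁
    have h₃ : star U⁻¹ = U⁻¹ := by rw [star_inv, h₂]
    exact congrArg Units.val h₃
  obtain ⟨m, hm, hnorm⟩ := hsa.exists_mem_spectrum_abs_eq_norm
  have hUv : (↑U⁻¹ : E →L[ℝ] E) ((U : E →L[ℝ] E) v) = v := by
    rw [← mul_apply_eq_comp, Units.inv_mul]; rfl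
  have hle : ‖v‖ ≤ ‖(↑U⁻¹ : E →L[ℝ] E)‖ * ‖A v - t • v‖ := by
    have := (↑U⁻¹ : E →L[ℝ] E).le_opNorm ((U : E →L[ℝ] E) v)
    rwa [hUv, hU, sub_algebraMap_apply] at this
  have hm0 : m ≠ 0 := by
    rintro rfl
    exact (spectrum.zero_mem_iff ℝ).1 hm U⁻¹.isUnit
  have hinv : m⁻¹ ∈ spectrum ℝ (U : E →L[ℝ] E) := by
    have := (spectrum.inv_mem_iff (r := Units.mk0 m hm0) (a := U⁻¹)).1 hm
    simpa using this
  rw [hU] at hinv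
  have hc' := h _ (add_mem_spectrum_of_mem_spectrum_sub hinv)
  rw [add_sub_cancel_right, abs_inv, hnorm] at hc'
  have hMpos : 0 < ‖(↑U⁻¹ : E →L[ℝ] E)‖ := by
    rw [← hnorm]; positivity
  calc c * ‖v‖ ≤ ‖(↑U⁻¹ : E →L[ℝ] E)‖⁻¹ * (‖(↑U⁻¹ : E →L[ℝ] E)‖ * ‖A v - t • v‖) := by gcongr
    _ = ‖A v - t • v‖ := by field_simp

end SelfAdjoint

section RankOne

variable {E : Type*} [NormedAddCommGroup E] [InnerProductSpace ℝ E]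

/-- The rank-one resolvent identity for `A' = A + δ ⟨e, ·⟩ e`, where `B`, `B'` invert `A`, `A'`. -/
lemma resolvent_rankOne {A A' B B' : E →L[ℝ] E} {e : E} {δ : ℝ} (hAB : ∀ v, A (B v) = v)
    (hBA' : ∀ v, B' (A' v) = v) (hA' : ∀ v, A' v = A v + (δ * inner ℝ e v) • e) (v : E) :
    B v = B' v + (δ * inner ℝ e (B v)) • B' e := by
  have h := hBA' (B v)
  rw [hA', hAB, map_add, map_smul] at h
  exact h.symm

lemma one_add_mul_inner_ne_zero {A A' B B' : E →L[ℝ] E} {e : E} {δ : ℝ} (he : e ≠ 0)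
    (hAB : ∀ v, A (B v) = v) (hBA' : ∀ v, B' (A' v) = v)
    (hA' : ∀ v, A' v = A v + (δ * inner ℝ e v) • e) : 1 + δ * inner ℝ e (B e) ≠ 0 := by
  intro h
  have h₁ : B e = (1 + δ * inner ℝ e (B e)) • B' e := by
    rw [add_smul, one_smul]
    exact resolvent_rankOne hAB hBA' hA' e
  rw [h, zero_smul] at h₁
  apply he
  rw [← hAB e, h₁, map_zero]

lemma rankOne_form_nonneg {A A' B B' : E →L[ℝ] E} {e v : E} {δ τ a : ℝ} (he : ‖e‖ = 1)
    (hAB : ∀ v, A (B v) = v) (hBA' : ∀ v, B' (A' v) = v)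
    (hB : ∀ v w, inner ℝ (B v) w = inner ℝ v (B w))
    (hA' : ∀ v, A' v = A v + (δ * inner ℝ e v) • e) (hev : inner ℝ e v = 0)
    (hτ : 0 < τ * (1 + δ * inner ℝ e (B e)))
    (hv : 0 ≤ τ * (‖v‖ ^ 2 + δ * inner ℝ v (B' v))) :
    0 ≤ τ * (‖a • e + v‖ ^ 2 + δ * inner ℝ (a • e + v) (B (a • e + v))) := by
  have hve : inner ℝ v e = 0 := by rw [real_inner_comm]; exact hev
  have hsym : inner ℝ v (B e) = inner ℝ e (B v) := by rw [← hB, real_inner_comm]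
  have h₁ := congrArg (inner ℝ v) (resolvent_rankOne hAB hBA' hA' v)
  have h₂ := congrArg (inner ℝ v) (resolvent_rankOne hAB hBA' hA' e)
  rw [inner_add_right, inner_smul_right] at h₁ h₂
  rw [hsym] at h₂
  have hn : ‖a • e + v‖ ^ 2 = a ^ 2 + ‖v‖ ^ 2 := by
    rw [norm_add_sq_real, inner_smul_left, hev, norm_smul, he]
    simp
  have hi : inner ℝ (a • e + v) (B (a • e + v))
      = a ^ 2 * inner ℝ e (B e) + 2 * a * inner ℝ e (B v) + inner ℝ v (B v) := by
    rw [map_add, map_smul, inner_add_left, inner_add_right, inner_add_right, inner_smul_left,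
      inner_smul_left, inner_smul_right, inner_smul_right, hsym]
    simp
    ring
  rw [hn, hi]
  generalize inner ℝ e (B e) = g at *
  generalize inner ℝ e (B v) = h at *
  generalize inner ℝ v (B' e) = k at *
  have hp : 1 + δ * g ≠ 0 := by
    intro h0
    rw [h0, mul_zero] at hτ
    exact lt_irrefl _ hτ
  have hk : k = h / (1 + δ * g) := by
    rw [eq_div_iff hp]
    linarith
  have key : τ * (a ^ 2 + ‖v‖ ^ 2 + δ * (a ^ 2 * g + 2 * a * h + inner ℝ v (B v)))
      = τ * (1 + δ * g) * (a + δ * h / (1 + δ * g)) ^ 2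
        + τ * (‖v‖ ^ 2 + δ * inner ℝ v (B' v)) := by
    rw [h₁, hk]
    field_simp
    ring
  rw [key]
  positivity

end RankOne

/-- The Hilbert space `ℓ²(ℤ)`. -/
abbrev ZSeq : Type := lp (fun _ : ℤ => ℝ) 2

section Sequences

/-- The standard basis vector of `ℓ²(ℤ)` at the site `j`. -/
noncomputable abbrev site (j : ℤ) : ZSeq := lp.single 2 j (1 : ℝ)

lemma site_apply (j n : ℤ) : site j n = if n = j then 1 else 0 := by
  rw [site, lp.single_apply, Pi.single_apply]

lemma inner_site (j : ℤ) (v : ZSeq) : inner ℝ (site j) v = v j := by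
  rw [site, lp.inner_single_left]
  simp

lemma norm_site (j : ℤ) : ‖site j‖ = 1 := by
  rw [site, lp.norm_single (by norm_num), norm_one]

lemma site_ne_zero (j : ℤ) : site j ≠ 0 := by
  rw [← norm_ne_zero_iff, norm_site]
  exact one_ne_zero

instance : Nontrivial ZSeq := ⟨site 0, 0, site_ne_zero 0⟩

lemma norm_le_mul_norm_of_abs_le {u v : ZSeq} {c : ℝ} (hc : 0 ≤ c)
    (h : ∀ n, |u n| ≤ c * |v n|) : ‖u‖ ≤ c * ‖v‖ := by
  have : ‖u‖ ≤ ‖c • v‖ := by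
    refine lp.norm_mono (by norm_num) fun n => ?_
    rw [lp.coeFn_smul, Pi.smul_apply, norm_smul, Real.norm_eq_abs, Real.norm_eq_abs,
      Real.norm_eq_abs, abs_of_nonneg hc]
    exact h n
  rwa [norm_smul, Real.norm_of_nonneg hc] at this

/-- Restriction of a sequence to finitely many sites. -/
noncomputable def truncate (s : Finset ℤ) (v : ZSeq) : ZSeq := ∑ i ∈ s, lp.single 2 i (v i)

lemma truncate_apply_of_notMem {s : Finset ℤ} {n : ℤ} (v : ZSeq) (hn : n ∉ s) :
    truncate s v n = 0 := by
  rw [truncate, lp.coeFn_sum, Finset.sum_apply]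
  refine Finset.sum_eq_zero fun i hi => ?_
  exact lp.single_apply_ne _ _ _ (by rintro rfl; exact hn hi)

lemma tendsto_truncate (v : ZSeq) :
    Filter.Tendsto (fun s => truncate s v) Filter.atTop (𝓝 v) :=
  lp.hasSum_single (by norm_num) v

/-- Translation of a sequence. -/
def shiftSeq (j : ℤ) (v : ZSeq) : ZSeq :=
  ⟨fun n => v (n + j), by
    have h : Memℓp (v : ℤ → ℝ) 2 := lp.memℓp v
    change Memℓp (fun n => v (n + j)) 2
    rw [memℓp_gen_iff (by norm_num)] at h ⊢
    exact (Equiv.addRight j).summable_iff.2 h⟩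

lemma shiftSeq_apply (j n : ℤ) (v : ZSeq) : shiftSeq j v n = v (n + j) := rfl

end Sequences

section WallForm

lemma eq_smul_site_add (j : ℤ) (v : ZSeq) : v = v j • site j + (v - v j • site j) := by abel

/-- If every single-site flip `A j ↦ A (j + 1)` crosses in the direction prescribed by `τ`, then
`1 + δ (A j)⁻¹` has the corresponding sign on vectors supported to the right of `j`. -/
lemma wall_form_nonneg {A B : ℤ → ZSeq →L[ℝ] ZSeq} {δ τ : ℝ}
    (hAB : ∀ j v, A j (B j v) = v) (hBA : ∀ j v, B j (A j v) = v)
    (hB : ∀ j v w, inner ℝ (B j v) w = inner ℝ v (B j w))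
    (hA : ∀ j v, A (j + 1) v = A j v + (δ * v j) • site j)
    (hτ : ∀ j, 0 < τ * (1 + δ * B j (site j) j)) (k : ℕ) :
    ∀ (j : ℤ) (v : ZSeq), (∀ n, v n ≠ 0 → j ≤ n ∧ n < j + k) →
      0 ≤ τ * (‖v‖ ^ 2 + δ * inner ℝ v (B j v)) := by
  induction k with
  | zero =>
    intro j v hv
    have : v = 0 := by
      ext n
      by_contra h
      have := hv n h
      simp at this
      omega
    simp [this]
  | succ k ih =>
    intro j v hv
    have happ : ∀ n, (v - v j • site j) n = if n = j then 0 else v n := by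
      intro n
      rw [lp.coeFn_sub, Pi.sub_apply, lp.coeFn_smul, Pi.smul_apply, site_apply]
      split_ifs with h <;> simp [h]
    rw [eq_smul_site_add j v]
    refine rankOne_form_nonneg (norm_site j) (hAB j) (hBA (j + 1)) (hB j) (fun w => ?_) ?_ ?_ ?_
    · rw [inner_site, hA]
    · rw [inner_site, happ, if_pos rfl]
    · rw [inner_site]
      exact hτ j
    · refine ih (j + 1) _ fun n hn => ?_
      rw [happ] at hn
      split_ifs at hn with h
      · exact absurd rfl hn
      · have := hv n hn
        push_cast at this
        omega

end WallForm

section Schrodinger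

/-- `A` acts on `ℓ²(ℤ)` as the discrete Schrödinger operator with potential `V`. -/
def IsSchrodinger (A : ZSeq →L[ℝ] ZSeq) (V : ℤ → ℝ) : Prop :=
  ∀ (ψ : ZSeq) (n : ℤ), A ψ n = ψ (n + 1) + ψ (n - 1) + V n * ψ n

namespace IsSchrodinger

variable {A A' : ZSeq →L[ℝ] ZSeq} {V V' : ℤ → ℝ}

lemma sub_apply (hA : IsSchrodinger A V) (hA' : IsSchrodinger A' V') (ψ : ZSeq) (n : ℤ) :
    (A' ψ - A ψ) n = (V' n - V n) * ψ n := by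
  rw [lp.coeFn_sub, Pi.sub_apply, hA, hA']
  ring

lemma sub_algebraMap (hA : IsSchrodinger A V) (t : ℝ) :
    IsSchrodinger (A - algebraMap ℝ (ZSeq →L[ℝ] ZSeq) t) (fun n => V n - t) := by
  intro ψ n
  rw [sub_algebraMap_apply, lp.coeFn_sub, Pi.sub_apply, lp.coeFn_smul, Pi.smul_apply, hA,
    smul_eq_mul]
  ring

lemma norm_sub_le (hA : IsSchrodinger A V) (hA' : IsSchrodinger A' V') {c : ℝ} (hc : 0 ≤ c)
    {ψ : ZSeq} (h : ∀ n, ψ n ≠ 0 → |V' n - V n| ≤ c) : ‖A' ψ - A ψ‖ ≤ c * ‖ψ‖ := by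
  refine norm_le_mul_norm_of_abs_le hc fun n => ?_
  rw [hA.sub_apply hA', abs_mul]
  rcases eq_or_ne (ψ n) 0 with h0 | h0
  · simp [h0]
  · gcongr
    exact h n h0

lemma eq_of_eq (hA : IsSchrodinger A V) (hA' : IsSchrodinger A' V') {ψ : ZSeq}
    (h : ∀ n, ψ n ≠ 0 → V' n = V n) : A' ψ = A ψ := by
  ext n
  have := hA.sub_apply hA' ψ n
  rw [lp.coeFn_sub, Pi.sub_apply] at this
  rcases eq_or_ne (ψ n) 0 with h0 | h0
  · rw [h0, mul_zero] at this
    linarith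
  · rw [h n h0, sub_self, zero_mul] at this
    linarith

lemma shiftSeq_apply (hA : IsSchrodinger A V) (hA' : IsSchrodinger A' V') {j : ℤ}
    (h : ∀ n, V' n = V (n + j)) (ψ : ZSeq) : A' (shiftSeq j ψ) = shiftSeq j (A ψ) := by
  ext n
  rw [hA', _root_.shiftSeq_apply, _root_.shiftSeq_apply, _root_.shiftSeq_apply,
    _root_.shiftSeq_apply, hA, h, add_right_comm n 1 j, sub_add_eq_add_sub]

end IsSchrodinger

lemma exists_truncate_norm_lt {A : ZSeq →L[ℝ] ZSeq} {t c : ℝ} {ψ : ZSeq}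
    (h : ‖A ψ - t • ψ‖ < c * ‖ψ‖) :
    ∃ s : Finset ℤ, ‖A (truncate s ψ) - t • truncate s ψ‖ < c * ‖truncate s ψ‖ := by
  have hopen : IsOpen {φ : ZSeq | ‖A φ - t • φ‖ < c * ‖φ‖} :=
    isOpen_lt (by fun_prop) (by fun_prop)
  exact ((tendsto_truncate ψ).eventually (hopen.mem_nhds h)).exists

lemma mem_of_truncate_ne_zero {s : Finset ℤ} {ψ : ZSeq} {n : ℤ} (h : truncate s ψ n ≠ 0) :
    n ∈ s := by
  by_contra hn
  exact h (truncate_apply_of_notMem ψ hn)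

/-- Schrödinger operators depend strongly continuously on a bounded potential. -/
lemma continuous_schrodinger_apply {X : Type*} [TopologicalSpace X] {A : X → ZSeq →L[ℝ] ZSeq}
    {V : X → ℤ → ℝ} (hA : ∀ x, IsSchrodinger (A x) (V x)) (hV : ∀ n, Continuous fun x => V x n)
    {K : ℝ} (hK : ∀ x n, |V x n| ≤ K) (ψ : ZSeq) : Continuous fun x => A x ψ := by
  rw [continuous_iff_continuousAt]
  intro x
  have hK0 : 0 ≤ K := (abs_nonneg _).trans (hK x 0)
  rw [ContinuousAt, Metric.tendsto_nhds]
  intro ε hε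
  set η := ε / (2 * (2 * K + 1)) with hη
  have hηpos : 0 < η := by positivity
  obtain ⟨s, hs⟩ := ((tendsto_truncate ψ).eventually (Metric.ball_mem_nhds ψ hηpos)).exists
  set φ := truncate s ψ with hφ
  have hφψ : ‖ψ - φ‖ < η := by rwa [dist_comm, dist_eq_norm] at hs
  set ζ := η / (‖φ‖ + 1) with hζ
  have hζpos : 0 < ζ := by positivity
  have hev : ∀ᶠ y in 𝓝 x, ∀ n ∈ s, |V y n - V x n| < ζ := by
    rw [Filter.eventually_all_finset]
    intro n _
    have := (hV n).continuousAt (x := x)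
    rw [ContinuousAt, Metric.tendsto_nhds] at this
    exact this ζ hζpos
  filter_upwards [hev] with y hy
  have h₁ : ‖A y φ - A x φ‖ ≤ ζ * ‖φ‖ :=
    (hA x).norm_sub_le (hA y) hζpos.le fun n hn => (hy n (mem_of_truncate_ne_zero hn)).le
  have h₂ : ‖A y (ψ - φ) - A x (ψ - φ)‖ ≤ (2 * K) * ‖ψ - φ‖ :=
    (hA x).norm_sub_le (hA y) (by positivity) fun n _ =>
      (abs_sub _ _).trans (by linarith [hK x n, hK y n])
  have h₃ : ζ * ‖φ‖ ≤ η := by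
    rw [hζ, div_mul_eq_mul_div, div_le_iff₀ (by positivity)]
    nlinarith [norm_nonneg φ]
  rw [dist_eq_norm]
  have e : A y ψ - A x ψ = (A y φ - A x φ) + (A y (ψ - φ) - A x (ψ - φ)) := by
    rw [map_sub, map_sub]
    abel
  have h₄ : η * (2 * (2 * K + 1)) = ε := by
    rw [hη]
    field_simp
  calc ‖A y ψ - A x ψ‖ ≤ ‖A y φ - A x φ‖ + ‖A y (ψ - φ) - A x (ψ - φ)‖ := by
        rw [e]
        exact norm_add_le _ _
    _ ≤ η + 2 * K * η := by
        refine add_le_add (h₁.trans h₃) (h₂.trans ?_)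
        gcongr
    _ < ε := by nlinarith

lemma continuous_inverse_apply {X : Type*} [TopologicalSpace X] {A B : X → ZSeq →L[ℝ] ZSeq}
    (hA : ∀ ψ, Continuous fun x => A x ψ) (hAB : ∀ x v, A x (B x v) = v)
    (hBA : ∀ x v, B x (A x v) = v) {C : ℝ} (hC : ∀ x v, ‖B x v‖ ≤ C * ‖v‖) (v : ZSeq) :
    Continuous fun x => B x v := by
  rw [continuous_iff_continuousAt]
  intro x
  rw [ContinuousAt, tendsto_iff_norm_sub_tendsto_zero]
  have h : Filter.Tendsto (fun y => C * ‖A x (B x v) - A y (B x v)‖) (𝓝 x) (𝓝 0) := by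
    have hc : Continuous fun y => C * ‖A x (B x v) - A y (B x v)‖ := by
      have := hA (B x v)
      fun_prop
    have := hc.tendsto x
    rwa [sub_self, norm_zero, mul_zero] at this
  refine squeeze_zero (fun _ => norm_nonneg _) (fun y => ?_) h
  have e : B y v - B x v = B y (A x (B x v) - A y (B x v)) := by
    rw [map_sub, hBA, hAB]
  rw [e]
  exact hC y _

end Schrodinger

section Wall

lemma exists_inverse_of_mul_norm_le {A : ZSeq →L[ℝ] ZSeq} (hA : IsSelfAdjoint A) {c : ℝ}
    (hc : 0 < c) (h : ∀ v, c * ‖v‖ ≤ ‖A v‖) :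
    ∃ B : ZSeq →L[ℝ] ZSeq, (∀ v, A (B v) = v) ∧ (∀ v, B (A v) = v) ∧
      (∀ v, ‖B v‖ ≤ c⁻¹ * ‖v‖) ∧ ∀ v w, inner ℝ (B v) w = inner ℝ v (B w) := by
  obtain ⟨U, rfl⟩ := hA.isUnit_of_mul_norm_le hc h
  have h₁ : ∀ v, (U : ZSeq →L[ℝ] ZSeq) ((↑U⁻¹ : ZSeq →L[ℝ] ZSeq) v) = v := fun v => by
    rw [← mul_apply_eq_comp, Units.mul_inv]; rfl
  have h₂ : ∀ v, (↑U⁻¹ : ZSeq →L[ℝ] ZSeq) ((U : ZSeq →L[ℝ] ZSeq) v) = v := fun v => by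
    rw [← mul_apply_eq_comp, Units.inv_mul]; rfl
  refine ⟨↑U⁻¹, h₁, h₂, fun v => ?_, fun v w => ?_⟩
  · rw [le_inv_mul_iff₀ hc]
    exact (h _).trans_eq (by rw [h₁])
  · conv_lhs => rw [← h₁ w, ← hA.inner_apply_comm, h₁]

variable {X : Type*} [TopologicalSpace X] {T : X ≃ₜ X} {g : X → ℝ}

lemma continuous_perm_zpow (T : X ≃ₜ X) (n : ℤ) : Continuous (T.toEquiv ^ n : Equiv.Perm X) := by
  induction n using Int.induction_on with
  | zero => exact continuous_id
  | succ n ih =>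
    rw [zpow_add_one, Equiv.Perm.coe_mul]
    exact ih.comp T.continuous
  | pred n ih =>
    rw [zpow_sub_one, Equiv.Perm.coe_mul]
    exact ih.comp T.symm.continuous

/-- All the single-site flips of a domain wall cross in the same direction when the base space is
connected. -/
lemma exists_wall_sign [ConnectedSpace X] [CompactSpace X] (hg : Continuous g) {a b c : ℝ}
    {A B : X → ℤ → ZSeq →L[ℝ] ZSeq}
    (hS : ∀ x j, IsSchrodinger (A x j)
      fun n => g ((T.toEquiv ^ n) x) + if n < j then b else a)
    (hAB : ∀ x j v, A x j (B x j v) = v) (hBA : ∀ x j v, B x j (A x j v) = v)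
    (hB : ∀ x j v, ‖B x j v‖ ≤ c⁻¹ * ‖v‖)
    (hA : ∀ x j v, A x (j + 1) v = A x j v + ((b - a) * v j) • site j) :
    ∃ τ : ℝ, (τ = 1 ∨ τ = -1) ∧ ∀ x j, 0 < τ * (1 + (b - a) * B x j (site j) j) := by
  have hne : ∀ x, 1 + (b - a) * B x 0 (site 0) 0 ≠ 0 := fun x => by
    rw [← inner_site 0]
    exact one_add_mul_inner_ne_zero (site_ne_zero 0) (hAB x 0) (hBA x (0 + 1)) fun v => by
      rw [inner_site, hA]
  have hshift : ∀ x j, B x j (site j) j = B ((T.toEquiv ^ j) x) 0 (site 0) 0 := fun x j => by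
    have h₁ : A ((T.toEquiv ^ j) x) 0 (shiftSeq j (B x j (site j))) = site 0 := by
      rw [(hS x j).shiftSeq_apply (hS _ 0) fun n => ?_, hAB]
      · ext n
        rw [shiftSeq_apply, site_apply, site_apply]
        simp
      · rw [← Equiv.Perm.mul_apply, ← zpow_add]
        simp
    rw [← h₁, hBA, shiftSeq_apply, zero_add]
  obtain ⟨K, hK⟩ : ∃ K, ∀ x, |g x| ≤ K := by
    obtain ⟨K, hK⟩ := isCompact_univ.exists_bound_of_continuousOn (f := g) hg.continuousOn
    exact ⟨K, fun x => hK x trivial⟩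
  have hcont : Continuous fun x => 1 + (b - a) * B x 0 (site 0) 0 := by
    have h₁ : Continuous fun x => B x 0 (site 0) := by
      refine continuous_inverse_apply (fun ψ => ?_) (hAB · 0) (hBA · 0) (hB · 0) _
      refine continuous_schrodinger_apply (hS · 0) (K := K + (|b| + |a|))
        (fun n => (hg.comp (continuous_perm_zpow T n)).add continuous_const) (fun x n => ?_) ψ
      refine (abs_add_le _ _).trans (add_le_add (hK _) ?_)
      split_ifs <;> linarith [abs_nonneg a, abs_nonneg b]
    have h₂ : Continuous fun x => inner ℝ (site 0) (B x 0 (site 0)) := by fun_prop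
    simp_rw [inner_site] at h₂
    fun_prop
  have hsign : (∀ x, 0 < 1 + (b - a) * B x 0 (site 0) 0) ∨
      ∀ x, 1 + (b - a) * B x 0 (site 0) 0 < 0 := by
    by_contra! hcon
    obtain ⟨⟨x, hx⟩, y, hy⟩ := hcon
    obtain ⟨z, hz⟩ := mem_range_of_exists_le_of_exists_ge hcont ⟨x, hx⟩ ⟨y, hy⟩
    exact hne z hz
  rcases hsign with h | h
  · refine ⟨1, Or.inl rfl, fun x j => ?_⟩
    rw [hshift, one_mul]
    exact h _
  · refine ⟨-1, Or.inr rfl, fun x j => ?_⟩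
    rw [hshift]
    linarith [h ((T.toEquiv ^ j) x)]

/-- An approximate eigenvector to the right of the wall detects the sign of the crossings. -/
lemma mul_add_nonneg_of_approx {A B : ZSeq →L[ℝ] ZSeq} {φ : ZSeq} {δ τ t c η : ℝ}
    (hδ : 0 < δ) (hτ : τ = 1 ∨ τ = -1) (hc : 0 < c) (hBA : ∀ v, B (A v) = v)
    (hB : ∀ v, ‖B v‖ ≤ c⁻¹ * ‖v‖) (hφ : ‖A φ - t • φ‖ < η * ‖φ‖)
    (hform : 0 ≤ τ * (‖φ‖ ^ 2 + δ * inner ℝ φ (B φ))) :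
    -(δ * |t| * c⁻¹ * η) ≤ τ * (t * (t + δ)) := by
  have hφ0 : 0 < ‖φ‖ := by
    rcases (norm_nonneg φ).eq_or_lt with h | h
    · rw [← h, mul_zero] at hφ
      exact absurd hφ (norm_nonneg _).not_gt
    · exact h
  have h₁ : ‖φ - t • B φ‖ ≤ c⁻¹ * (η * ‖φ‖) := by
    have := hB (A φ - t • φ)
    rw [map_sub, map_smul, hBA] at this
    exact this.trans (by gcongr)
  have h₂ : |‖φ‖ ^ 2 - t * inner ℝ φ (B φ)| ≤ ‖φ‖ * (c⁻¹ * (η * ‖φ‖)) := by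
    have := abs_real_inner_le_norm φ (φ - t • B φ)
    rw [inner_sub_right, inner_smul_right, real_inner_self_eq_norm_sq] at this
    exact this.trans (by gcongr)
  set q := inner ℝ φ (B φ)
  have h₃ : |δ * t * (‖φ‖ ^ 2 - t * q)| ≤ δ * |t| * c⁻¹ * η * ‖φ‖ ^ 2 := by
    rw [abs_mul, abs_mul, abs_of_pos hδ]
    calc _ ≤ δ * |t| * (‖φ‖ * (c⁻¹ * (η * ‖φ‖))) := by gcongr
      _ = _ := by ring
  have h₄ : 0 ≤ t ^ 2 * (τ * (‖φ‖ ^ 2 + δ * q)) := by positivity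
  have h₅ : 0 ≤ (τ * (t * (t + δ)) + δ * |t| * c⁻¹ * η) * ‖φ‖ ^ 2 := by
    have := abs_le.1 h₃
    rcases hτ with rfl | rfl <;> nlinarith
  have := nonneg_of_mul_nonneg_left h₅ (by positivity)
  linarith

end Wall

section Probability

variable {ν : Measure ℝ} {S : Set ℝ} {ν' : Measure (ℤ → ℝ)}

lemma eq_support_of_eq_setOf (hS : S = {v : ℝ | ∀ U ∈ 𝓝 v, ν U ≠ 0}) : S = ν.support := by
  ext v
  rw [hS, Measure.mem_support_iff_forall]
  simp only [Set.mem_ofPred_eq, pos_iff_ne_zero]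

lemma ae_forall_mem_support (hS : S = ν.support) (hScompact : IsCompact S)
    (hν' : ∀ (F : Finset ℤ) (t : ℤ → Set ℝ), (∀ i, MeasurableSet (t i)) →
      ν' {ω | ∀ i ∈ F, ω i ∈ t i} = ∏ i ∈ F, ν (t i)) :
    ∀ᵐ ω ∂ν', ∀ n, ω n ∈ S := by
  rw [ae_all_iff]
  intro n
  have h := hν' {n} (fun _ => Sᶜ) fun _ => hScompact.measurableSet.compl
  rw [Finset.prod_singleton, hS, Measure.measure_compl_support] at h
  rw [ae_iff, hS]
  simpa using h

lemma measure_cylinder_ne_zero (hS : S = ν.support)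
    (hν' : ∀ (F : Finset ℤ) (t : ℤ → Set ℝ), (∀ i, MeasurableSet (t i)) →
      ν' {ω | ∀ i ∈ F, ω i ∈ t i} = ∏ i ∈ F, ν (t i))
    {ω : ℤ → ℝ} (hω : ∀ n, ω n ∈ S) (F : Finset ℤ) {η : ℝ} (hη : 0 < η) :
    ν' {ω' | ∀ i ∈ F, ω' i ∈ Metric.ball (ω i) η} ≠ 0 := by
  rw [hν' F _ fun _ => measurableSet_ball]
  refine Finset.prod_ne_zero_iff.2 fun i _ => ?_
  have := hω i
  rw [hS, Measure.mem_support_iff_forall] at this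
  exact (this _ (Metric.ball_mem_nhds _ hη)).ne'

end Probability

section AlmostSure

lemma IsCompact.exists_forall_le_abs_sub {Λ : Set ℝ} (hΛ : IsCompact Λ) {E : ℝ} (hE : E ∉ Λ) :
    ∃ c > 0, ∀ m ∈ Λ, c ≤ |m - E| := by
  obtain ⟨c, hc, hball⟩ := Metric.isOpen_iff.1 hΛ.isClosed.isOpen_compl E hE
  refine ⟨c, hc, fun m hm => ?_⟩
  by_contra! h
  exact hball (Metric.mem_ball.2 h) hm

variable {X : Type*} [TopologicalSpace X] [MeasurableSpace X] {T : X ≃ₜ X} {μ : Measure X}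
  [IsProbabilityMeasure μ] {f : C(X, ℝ)} {ν : Measure ℝ} {S : Set ℝ} {ν' : Measure (ℤ → ℝ)}
  [IsProbabilityMeasure ν'] {H' : X → (ℤ → ℝ) → (ZSeq →L[ℝ] ZSeq)} {Λ₁ : Set ℝ}

omit [IsProbabilityMeasure μ] in
/-- Outside the almost sure spectrum, the resolvents of all realizations are uniformly bounded. -/
lemma exists_pos_forall_mul_norm_le (hfull : ∀ U : Set X, IsOpen U → U.Nonempty → μ U ≠ 0)
    (hS : S = ν.support) (hScompact : IsCompact S)
    (hν' : ∀ (F : Finset ℤ) (t : ℤ → Set ℝ), (∀ i, MeasurableSet (t i)) →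
      ν' {ω | ∀ i ∈ F, ω i ∈ t i} = ∏ i ∈ F, ν (t i))
    (hH' : ∀ (x : X) (ω : ℤ → ℝ), (∀ n, ω n ∈ S) →
      IsSchrodinger (H' x ω) fun n => f ((T.toEquiv ^ n) x) + ω n)
    (hH'sa : ∀ x ω, (∀ n, ω n ∈ S) → IsSelfAdjoint (H' x ω))
    (hΛ₁compact : IsCompact Λ₁)
    (hΛ₁ : ∀ᵐ p ∂(μ.prod ν'), spectrum ℝ (H' p.1 p.2) = Λ₁) {E : ℝ} (hE : E ∉ Λ₁) :
    ∃ c > 0, ∀ x ω, (∀ n, ω n ∈ S) → ∀ v, c * ‖v‖ ≤ ‖H' x ω v - E • v‖ := by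
  obtain ⟨c, hc, hdist⟩ := hΛ₁compact.exists_forall_le_abs_sub hE
  refine ⟨c, hc, fun x ω hω v => ?_⟩
  by_contra! hlt
  obtain ⟨s, hs⟩ := exists_truncate_norm_lt hlt
  set φ := truncate s v with hφ
  obtain ⟨η, hη, hηlt⟩ : ∃ η > 0, ‖H' x ω φ - E • φ‖ + η * ‖φ‖ < c * ‖φ‖ := by
    refine ⟨(c * ‖φ‖ - ‖H' x ω φ - E • φ‖) / (2 * (‖φ‖ + 1)),
      div_pos (by linarith) (by positivity), ?_⟩
    have : (c * ‖φ‖ - ‖H' x ω φ - E • φ‖) / (2 * (‖φ‖ + 1)) * ‖φ‖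
        < c * ‖φ‖ - ‖H' x ω φ - E • φ‖ := by
      rw [div_mul_eq_mul_div, div_lt_iff₀ (by positivity)]
      nlinarith [norm_nonneg φ]
    linarith
  have hη2 : 0 < η / 2 := by positivity
  set U := {y : X | ∀ n ∈ s, |f ((T.toEquiv ^ n) y) - f ((T.toEquiv ^ n) x)| < η / 2} with hU
  have hUopen : IsOpen U := by
    have : U = ⋂ n ∈ s, {y : X | |f ((T.toEquiv ^ n) y) - f ((T.toEquiv ^ n) x)| < η / 2} := by
      ext y
      simp [hU]
    rw [this]
    refine isOpen_biInter_finset fun n _ => isOpen_lt ?_ continuous_const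
    exact ((f.continuous.comp (continuous_perm_zpow T n)).sub continuous_const).abs
  have hUne : U.Nonempty := ⟨x, fun n _ => by rw [sub_self, abs_zero]; exact hη2⟩
  have hpos : (μ.prod ν') (U ×ˢ {ω' | ∀ i ∈ s, ω' i ∈ Metric.ball (ω i) (η / 2)}) ≠ 0 := by
    rw [Measure.prod_prod]
    exact mul_ne_zero (hfull U hUopen hUne) (measure_cylinder_ne_zero hS hν' hω s hη2)
  have hae := hΛ₁.and ((Measure.quasiMeasurePreserving_snd (μ := μ) (ν := ν')).ae
    (ae_forall_mem_support hS hScompact hν'))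
  obtain ⟨⟨y, ω'⟩, ⟨hy, hω's⟩, hspec, hω'⟩ :=
    ((frequently_ae_mem_iff.2 hpos).and_eventually hae).exists
  have h₁ := (hH'sa y ω' hω').mul_norm_le_norm_sub_smul hc (fun m hm => hdist m (hspec ▸ hm)) φ
  have h₂ : ‖H' y ω' φ - H' x ω φ‖ ≤ η * ‖φ‖ := by
    refine (hH' x ω hω).norm_sub_le (hH' y ω' hω') hη.le fun n hn => ?_
    have hns := mem_of_truncate_ne_zero hn
    have h₃ := hy n hns
    have h₄ := hω's n hns
    rw [Metric.mem_ball, Real.dist_eq] at h₄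
    have e : f ((T.toEquiv ^ n) y) + ω' n - (f ((T.toEquiv ^ n) x) + ω n)
        = (f ((T.toEquiv ^ n) y) - f ((T.toEquiv ^ n) x)) + (ω' n - ω n) := by ring
    rw [e]
    exact (abs_add_le _ _).trans (by linarith)
  have h₅ : ‖H' y ω' φ - E • φ‖ ≤ ‖H' x ω φ - E • φ‖ + ‖H' y ω' φ - H' x ω φ‖ := by
    have e : H' y ω' φ - E • φ = (H' x ω φ - E • φ) + (H' y ω' φ - H' x ω φ) := by abel
    rw [e]
    exact norm_add_le _ _
  linarith

variable {A : ZSeq →L[ℝ] ZSeq} {V : ℤ → ℝ} {Λ₀ : Set ℝ}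

lemma sub_notMem_of_mul_norm_le {A' : ZSeq →L[ℝ] ZSeq} (hA : IsSchrodinger A V)
    (hAsa : IsSelfAdjoint A) {s E c : ℝ} (hA' : IsSchrodinger A' fun n => V n + s) (hc : 0 < c)
    (h : ∀ v, c * ‖v‖ ≤ ‖A' v - E • v‖) : E - s ∉ spectrum ℝ A := by
  refine hAsa.notMem_spectrum_of_mul_norm_le hc fun v => ?_
  have e : A v - (E - s) • v = A' v - E • v := by
    ext n
    simp only [lp.coeFn_sub, lp.coeFn_smul, Pi.sub_apply, Pi.smul_apply, smul_eq_mul]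
    rw [hA, hA']
    ring
  rw [e]
  exact h v

omit [MeasurableSpace X] in
/-- For `a < b` in `S`, the unperturbed spectrum lies either entirely inside `[E - b, E - a]` or
entirely outside its interior. -/
lemma gap_dichotomy [CompactSpace X] [ConnectedSpace X] {H : X → (ZSeq →L[ℝ] ZSeq)}
    (hH : ∀ x, IsSchrodinger (H x) fun n => f ((T.toEquiv ^ n) x))
    (hHsa : ∀ x, IsSelfAdjoint (H x))
    (hH' : ∀ (x : X) (ω : ℤ → ℝ), (∀ n, ω n ∈ S) →
      IsSchrodinger (H' x ω) fun n => f ((T.toEquiv ^ n) x) + ω n)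
    (hH'sa : ∀ x ω, (∀ n, ω n ∈ S) → IsSelfAdjoint (H' x ω)) {E c : ℝ} (hc : 0 < c)
    (hbound : ∀ x ω, (∀ n, ω n ∈ S) → ∀ v, c * ‖v‖ ≤ ‖H' x ω v - E • v‖)
    {a b : ℝ} (ha : a ∈ S) (hb : b ∈ S) (hab : a < b) :
    (∀ x, ∀ e ∈ spectrum ℝ (H x), 0 ≤ (e + a - E) * (e + b - E)) ∨
      ∀ x, ∀ e ∈ spectrum ℝ (H x), (e + a - E) * (e + b - E) ≤ 0 := by
  set w : ℤ → ℤ → ℝ := fun j n => if n < j then b else a with hw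
  have hwS : ∀ j n, w j n ∈ S := fun j n => by
    simp only [hw]
    split_ifs <;> assumption
  set A : X → ℤ → (ZSeq →L[ℝ] ZSeq) :=
    fun x j => H' x (w j) - algebraMap ℝ (ZSeq →L[ℝ] ZSeq) E with hAdef
  have hAS : ∀ x j, IsSchrodinger (A x j)
      fun n => (f ((T.toEquiv ^ n) x) - E) + if n < j then b else a := fun x j => by
    convert (hH' x (w j) (hwS j)).sub_algebraMap E using 2
    simp only [hw]
    ring
  choose B hAB hBA hB hBsym using fun x j =>
    exists_inverse_of_mul_norm_le ((hH'sa x (w j) (hwS j)).sub_algebraMap E) hc fun v => by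
      rw [sub_algebraMap_apply]
      exact hbound x _ (hwS j) v
  have hflip : ∀ x j v, A x (j + 1) v = A x j v + ((b - a) * v j) • site j := fun x j v => by
    ext n
    have := (hAS x j).sub_apply (hAS x (j + 1)) v n
    rw [lp.coeFn_sub, Pi.sub_apply] at this
    rw [lp.coeFn_add, Pi.add_apply, lp.coeFn_smul, Pi.smul_apply, site_apply, smul_eq_mul,
      ← sub_eq_iff_eq_add', this]
    rcases lt_trichotomy n j with h | h | h
    · rw [if_pos (by omega), if_pos h, if_neg h.ne]
      ring
    · rw [if_pos (by omega), if_neg (by omega), if_pos h, h]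
      ring
    · rw [if_neg (by omega), if_neg (by omega), if_neg h.ne']
      ring
  obtain ⟨τ, hτ, hsign⟩ := exists_wall_sign (T := T) (g := fun x => f x - E)
    (f.continuous.sub continuous_const) hAS hAB hBA hB hflip
  have key : ∀ x, ∀ e ∈ spectrum ℝ (H x), 0 ≤ τ * ((e + a - E) * (e + b - E)) := by
    intro x e he
    have happrox : ∀ η > 0, -((b - a) * |e + a - E| * c⁻¹ * η)
        ≤ τ * ((e + a - E) * (e + a - E + (b - a))) := by
      intro η hη
      obtain ⟨ψ, hψ⟩ := (hHsa x).exists_norm_sub_lt_of_mem_spectrum hη he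
      obtain ⟨s, hs⟩ := exists_truncate_norm_lt hψ
      obtain ⟨N, hN⟩ : ∃ N : ℕ, ∀ n ∈ s, |n| < N := by
        obtain ⟨N, hN⟩ := (s.image Int.natAbs).exists_nat_subset_range
        refine ⟨N, fun n hn => ?_⟩
        have := Finset.mem_range.1 (hN (Finset.mem_image_of_mem _ hn))
        rw [Int.abs_eq_natAbs]
        exact_mod_cast this
      have hsupp : ∀ n, truncate s ψ n ≠ 0 → -(N : ℤ) ≤ n ∧ n < -(N : ℤ) + (2 * N : ℕ) := by
        intro n hn
        have := abs_lt.1 (hN n (mem_of_truncate_ne_zero hn))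
        push_cast
        omega
      refine mul_add_nonneg_of_approx (A := A x (-N)) (B := B x (-N)) (φ := truncate s ψ)
        (sub_pos.2 hab) hτ hc (hBA x _) (hB x _) ?_
        (wall_form_nonneg (hAB x) (hBA x) (hBsym x) (hflip x) (hsign x) (2 * N) _ _ hsupp)
      have hright : A x (-N) (truncate s ψ)
          = (H x - algebraMap ℝ (ZSeq →L[ℝ] ZSeq) (E - a)) (truncate s ψ) := by
        refine ((hH x).sub_algebraMap (E - a)).eq_of_eq (hAS x (-N)) fun n hn => ?_
        rw [if_neg (not_lt.2 (hsupp n hn).1)]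
        ring
      rw [hright, sub_algebraMap_apply]
      convert hs using 2
      module
    have hlim : Filter.Tendsto (fun η : ℝ => -((b - a) * |e + a - E| * c⁻¹ * η)) (𝓝[>] 0)
        (𝓝 0) := by
      have : Continuous fun η : ℝ => -((b - a) * |e + a - E| * c⁻¹ * η) := by fun_prop
      have := this.tendsto 0
      rw [mul_zero, neg_zero] at this
      exact this.mono_left nhdsWithin_le_nhds
    have hle : 0 ≤ τ * ((e + a - E) * (e + a - E + (b - a))) :=
      le_of_tendsto hlim (Filter.mem_of_superset self_mem_nhdsWithin happrox)
    rwa [show e + a - E + (b - a) = e + b - E by ring] at hle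
  rcases hτ with rfl | rfl
  · left
    intro x e he
    have := key x e he
    linarith
  · right
    intro x e he
    have := key x e he
    linarith

end AlmostSure

section Bounds

variable {A A' : ZSeq →L[ℝ] ZSeq} {V ω : ℤ → ℝ} {S : Set ℝ}

lemma abs_sub_midpoint_le {a b x : ℝ} (hx : x ∈ Set.Icc a b) :
    |x - (a + b) / 2| ≤ (b - a) / 2 := by
  rw [abs_le]
  constructor <;> linarith [hx.1, hx.2]

/-- A perturbation with values in `[a, b]` moves the spectrum inside `σ(A) + [a, b]`. -/
lemma spectrum_subset_spectrum_add_Icc (hA : IsSchrodinger A V) (hAsa : IsSelfAdjoint A)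
    (hA' : IsSchrodinger A' fun n => V n + ω n) (hA'sa : IsSelfAdjoint A') {a b : ℝ}
    (hω : ∀ n, ω n ∈ Set.Icc a b) (hcomp : IsCompact (spectrum ℝ A)) :
    spectrum ℝ A' ⊆ spectrum ℝ A + Set.Icc a b := by
  intro E hE
  by_contra hcon
  obtain ⟨c, hc, hdist⟩ := (hcomp.add isCompact_Icc).exists_forall_le_abs_sub hcon
  have hab : a ≤ b := (hω 0).1.trans (hω 0).2
  have hlow : ∀ m ∈ spectrum ℝ A, (b - a) / 2 + c ≤ |m - (E - (a + b) / 2)| := by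
    intro m hm
    by_contra! hlt
    rw [abs_lt] at hlt
    have h : ∀ t ∈ Set.Icc a b, c ≤ |m + t - E| := fun t ht => hdist _ (Set.add_mem_add hm ht)
    rcases le_total (E - m) a with h₁ | h₁
    · have := h a ⟨le_rfl, hab⟩
      rw [abs_of_nonneg (by linarith)] at this
      linarith
    · rcases le_total (E - m) b with h₂ | h₂
      · have := h (E - m) ⟨h₁, h₂⟩
        rw [add_sub_cancel, sub_self, abs_zero] at this
        linarith
      · have := h b ⟨hab, le_rfl⟩
        rw [abs_of_nonpos (by linarith)] at this
        linarith
  refine hA'sa.notMem_spectrum_of_mul_norm_le hc (fun v => ?_) hE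
  have h₁ := hAsa.mul_norm_le_norm_sub_smul (by linarith) hlow v
  have h₂ : ‖A' v - E • v - (A v - (E - (a + b) / 2) • v)‖ ≤ (b - a) / 2 * ‖v‖ := by
    refine norm_le_mul_norm_of_abs_le (by linarith) fun n => ?_
    have e : (A' v - E • v - (A v - (E - (a + b) / 2) • v)) n
        = (ω n - (a + b) / 2) * v n := by
      simp only [lp.coeFn_sub, lp.coeFn_smul, Pi.sub_apply, Pi.smul_apply, smul_eq_mul]
      rw [hA, hA']
      ring
    rw [e, abs_mul]
    gcongr
    exact abs_sub_midpoint_le (hω n)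
  have h₃ := norm_sub_norm_le (A v - (E - (a + b) / 2) • v) (A' v - E • v)
  rw [norm_sub_rev (A v - (E - (a + b) / 2) • v)] at h₃
  linarith

/-- Adding an operator with spectrum in `[a, b]` to a diagonal one with entries in `S` gives
spectrum inside `[a, b] + S`. -/
lemma spectrum_subset_Icc_add (hA : IsSchrodinger A V) (hAsa : IsSelfAdjoint A)
    (hA' : IsSchrodinger A' fun n => V n + ω n) (hA'sa : IsSelfAdjoint A') {a b : ℝ}
    (hab : a ≤ b) (hspec : spectrum ℝ A ⊆ Set.Icc a b) (hω : ∀ n, ω n ∈ S)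
    (hcomp : IsCompact S) : spectrum ℝ A' ⊆ Set.Icc a b + S := by
  intro E hE
  by_contra hcon
  obtain ⟨c, hc, hdist⟩ := (isCompact_Icc.add hcomp).exists_forall_le_abs_sub hcon
  have hlow : ∀ s ∈ S, (b - a) / 2 + c ≤ |s - (E - (a + b) / 2)| := by
    intro m hm
    by_contra! hlt
    rw [abs_lt] at hlt
    have h : ∀ t ∈ Set.Icc a b, c ≤ |t + m - E| := fun t ht => hdist _ (Set.add_mem_add ht hm)
    rcases le_total (E - m) a with h₁ | h₁
    · have := h a ⟨le_rfl, hab⟩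
      rw [abs_of_nonneg (by linarith)] at this
      linarith
    · rcases le_total (E - m) b with h₂ | h₂
      · have := h (E - m) ⟨h₁, h₂⟩
        rw [sub_add_cancel, sub_self, abs_zero] at this
        linarith
      · have := h b ⟨hab, le_rfl⟩
        rw [abs_of_nonpos (by linarith)] at this
        linarith
  refine hA'sa.notMem_spectrum_of_mul_norm_le hc (fun v => ?_) hE
  have h₁ := hAsa.norm_sub_smul_le (fun m hm => abs_sub_midpoint_le (hspec hm)) v
  have h₂ : ‖v‖ ≤ ((b - a) / 2 + c)⁻¹ * ‖A' v - E • v - (A v - ((a + b) / 2) • v)‖ := by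
    have hpos : 0 < (b - a) / 2 + c := by linarith
    refine norm_le_mul_norm_of_abs_le (by positivity) fun n => ?_
    have e : (A' v - E • v - (A v - ((a + b) / 2) • v)) n
        = (ω n - (E - (a + b) / 2)) * v n := by
      simp only [lp.coeFn_sub, lp.coeFn_smul, Pi.sub_apply, Pi.smul_apply, smul_eq_mul]
      rw [hA, hA']
      ring
    rw [e, abs_mul, le_inv_mul_iff₀ hpos]
    gcongr
    exact hlow _ (hω n)
  rw [le_inv_mul_iff₀ (by linarith)] at h₂
  have h₃ := norm_sub_le (A' v - E • v) (A v - ((a + b) / 2) • v)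
  linarith

end Bounds

section StarOp

lemma starOp_subset {Λ₀ Λ₁ S : Set ℝ} (hΛ₀ : IsCompact Λ₀) (hΛ₀ne : Λ₀.Nonempty)
    (hS : IsCompact S) (hStwo : S.Nontrivial)
    (hgap : ∀ E ∉ Λ₁, (∀ s ∈ S, E - s ∉ Λ₀) ∧ ∀ a ∈ S, ∀ b ∈ S, a < b →
      (∀ e ∈ Λ₀, 0 ≤ (e + a - E) * (e + b - E)) ∨
        ∀ e ∈ Λ₀, (e + a - E) * (e + b - E) ≤ 0) :
    starOp Λ₀ S ⊆ Λ₁ := by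
  have hm := hS.sInf_mem hStwo.nonempty
  have hM := hS.sSup_mem hStwo.nonempty
  have hl := hΛ₀.sInf_mem hΛ₀ne
  have hL := hΛ₀.sSup_mem hΛ₀ne
  have hSle : ∀ s ∈ S, sInf S ≤ s ∧ s ≤ sSup S := fun s hs =>
    ⟨csInf_le hS.bddBelow hs, le_csSup hS.bddAbove hs⟩
  have hmM : sInf S < sSup S := by
    obtain ⟨x, hx, y, hy, hxy⟩ := hStwo
    rcases lt_or_gt_of_ne hxy with h | h
    · exact ((hSle x hx).1.trans_lt h).trans_le (hSle y hy).2
    · exact ((hSle y hy).1.trans_lt h).trans_le (hSle x hx).2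
  intro E hE
  by_contra hEΛ
  obtain ⟨hout, hdich⟩ := hgap E hEΛ
  have hne : ∀ e ∈ Λ₀, ∀ s ∈ S, e + s - E ≠ 0 := fun e he s hs h =>
    hout s hs (by rwa [show E - s = e by linarith])
  have hdich' : ∀ a ∈ S, ∀ b ∈ S, a < b → ∀ e ∈ Λ₀, e + a < E → E < e + b →
      ∀ e' ∈ Λ₀, e' + a < E ∧ E < e' + b := by
    intro a ha b hb hab e he hea heb e' he'
    rcases hdich a ha b hb hab with h | h
    · have := h e he
      nlinarith
    · have h' := h e' he'
      have ha' := hne e' he' a ha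
      have hb' := hne e' he' b hb
      constructor
      · by_contra! hcon
        have : 0 < e' + a - E := lt_of_le_of_ne (by linarith) ha'.symm
        nlinarith
      · by_contra! hcon
        have : e' + b - E < 0 := lt_of_le_of_ne (by linarith) hb'
        nlinarith
  rw [starOp] at hE
  split_ifs at hE with hdiam
  · obtain ⟨e, he, s, hs, rfl⟩ := Set.mem_add.1 hE
    have h₁ : e + sInf S < e + s :=
      lt_of_le_of_ne (by linarith [hs.1]) fun h => hne e he _ hm (by linarith)
    have h₂ : e + s < e + sSup S :=
      lt_of_le_of_ne (by linarith [hs.2]) fun h => hne e he _ hM (by linarith)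
    have h₃ := hdich' _ hm _ hM hmM e he h₁ h₂
    linarith [(h₃ _ hl).2, (h₃ _ hL).1]
  · obtain ⟨t, ht, s, hs, rfl⟩ := Set.mem_add.1 hE
    have h₁ : sInf Λ₀ < t :=
      lt_of_le_of_ne ht.1 fun h => hne _ hl s hs (by linarith)
    have h₂ : t < sSup Λ₀ :=
      lt_of_le_of_ne ht.2 fun h => hne _ hL s hs (by linarith)
    rcases lt_or_ge (sSup Λ₀ + sInf S) (t + s) with h | h
    · have := hdich' _ hm _ hs (by linarith) _ hL h (by linarith) _ hl
      linarith
    · have := hdich' _ hs _ hM (by linarith) _ hl (by linarith) (by linarith) _ hL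
      linarith

end StarOp

/-- **Main Theorem.** If the hull `X` is connected, then the almost sure
spectrum of the randomly perturbed ergodic Schrödinger operator satisfies `Σ₁ = Σ₀ ⋆ S`. -/
theorem perturbed_spectrum_eq_star
    {X : Type*} [MetricSpace X] [CompactSpace X] [Nonempty X] [ConnectedSpace X]
    [MeasurableSpace X] [BorelSpace X]
    -- `T` is a homeomorphism of `X`
    (T : X ≃ₜ X)
    -- `μ` is an ergodic Borel probability measure with full topological support
    (μ : Measure X) [IsProbabilityMeasure μ]
    (hT : Ergodic T μ)
    (hfull : ∀ U : Set X, IsOpen U → U.Nonempty → μ U ≠ 0)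
    -- the continuous sampling function
    (f : C(X, ℝ))
    -- the unperturbed Schrödinger operators `H_x` on `ℓ²(ℤ)`
    (H : X → (lp (fun _ : ℤ => ℝ) 2 →L[ℝ] lp (fun _ : ℤ => ℝ) 2))
    (hH : ∀ (x : X) (ψ : lp (fun _ : ℤ => ℝ) 2) (n : ℤ),
      (H x ψ) n = ψ (n + 1) + ψ (n - 1) + f ((T.toEquiv ^ n) x) * ψ n)
    (hHsa : ∀ x, IsSelfAdjoint (H x))
    -- the unperturbed almost sure spectrum `Λ₀`
    (Λ₀ : Set ℝ) (hΛ₀compact : IsCompact Λ₀)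
    (hΛ₀ : ∀ᵐ x ∂μ, spectrum ℝ (H x) = Λ₀)
    -- the single-site measure `ν` with compact support `S` containing at least two points
    (ν : Measure ℝ) [IsProbabilityMeasure ν]
    (S : Set ℝ) (hS : S = {v : ℝ | ∀ U ∈ 𝓝 v, ν U ≠ 0})
    (hScompact : IsCompact S) (hStwo : S.Nontrivial)
    -- `ν'` is the product measure `ν^ℤ` on `ℝ^ℤ`
    (ν' : Measure (ℤ → ℝ)) [IsProbabilityMeasure ν']
    (hν' : ∀ (F : Finset ℤ) (t : ℤ → Set ℝ), (∀ i, MeasurableSet (t i)) →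
      ν' {ω | ∀ i ∈ F, ω i ∈ t i} = ∏ i ∈ F, ν (t i))
    -- the perturbed Schrödinger operators `H_{x,ω}` on `ℓ²(ℤ)`
    (H' : X → (ℤ → ℝ) → (lp (fun _ : ℤ => ℝ) 2 →L[ℝ] lp (fun _ : ℤ => ℝ) 2))
    (hH' : ∀ (x : X) (ω : ℤ → ℝ), (∀ n, ω n ∈ S) →
      ∀ (ψ : lp (fun _ : ℤ => ℝ) 2) (n : ℤ),
        (H' x ω ψ) n = ψ (n + 1) + ψ (n - 1) + (f ((T.toEquiv ^ n) x) + ω n) * ψ n)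
    (hH'sa : ∀ x ω, (∀ n, ω n ∈ S) → IsSelfAdjoint (H' x ω))
    -- the perturbed almost sure spectrum `Λ₁`
    (Λ₁ : Set ℝ) (hΛ₁compact : IsCompact Λ₁)
    (hΛ₁ : ∀ᵐ p ∂(μ.prod ν'), spectrum ℝ (H' p.1 p.2) = Λ₁) :
    Λ₁ = starOp Λ₀ S := by
  have hSsupp := eq_support_of_eq_setOf hS
  have hHS : ∀ x, IsSchrodinger (H x) fun n => f ((T.toEquiv ^ n) x) := hH
  have hHS' : ∀ (x : X) (ω : ℤ → ℝ), (∀ n, ω n ∈ S) →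
      IsSchrodinger (H' x ω) fun n => f ((T.toEquiv ^ n) x) + ω n := hH'
  obtain ⟨⟨x, ω⟩, ⟨hspec₁, hspec₀⟩, hω⟩ := ((hΛ₁.and
    ((Measure.quasiMeasurePreserving_fst (μ := μ) (ν := ν')).ae hΛ₀)).and
    ((Measure.quasiMeasurePreserving_snd (μ := μ) (ν := ν')).ae
      (ae_forall_mem_support hSsupp hScompact hν'))).exists
  dsimp only at hspec₁ hspec₀ hω
  have hΛ₀ne : Λ₀.Nonempty := by
    obtain ⟨m, hm, -⟩ := (hHsa x).exists_mem_spectrum_abs_eq_norm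
    exact ⟨m, hspec₀ ▸ hm⟩
  have hIcc : ∀ {K : Set ℝ}, IsCompact K → K ⊆ Set.Icc (sInf K) (sSup K) := fun hK k hk =>
    ⟨csInf_le hK.bddBelow hk, le_csSup hK.bddAbove hk⟩
  refine Set.Subset.antisymm ?_ (starOp_subset hΛ₀compact hΛ₀ne hScompact hStwo fun E hE => ?_)
  · rw [starOp]
    split_ifs
    · have := spectrum_subset_spectrum_add_Icc (hHS x) (hHsa x) (hHS' x ω hω) (hH'sa x ω hω)
        (fun n => hIcc hScompact (hω n)) (hspec₀ ▸ hΛ₀compact)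
      rwa [hspec₀, hspec₁] at this
    · have := spectrum_subset_Icc_add (hHS x) (hHsa x) (hHS' x ω hω) (hH'sa x ω hω)
        (Real.sInf_le_sSup Λ₀ hΛ₀compact.bddBelow hΛ₀compact.bddAbove)
        (hspec₀.trans_subset (hIcc hΛ₀compact)) hω hScompact
      rwa [hspec₁] at this
  · obtain ⟨c, hc, hbound⟩ := exists_pos_forall_mul_norm_le hfull hSsupp hScompact hν' hHS' hH'sa
      hΛ₁compact hΛ₁ hE
    refine ⟨fun s hs => ?_, fun a ha b hb hab => ?_⟩
    · rw [← hspec₀]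
      exact sub_notMem_of_mul_norm_le (hHS x) (hHsa x) (hHS' x (fun _ => s) fun _ => hs) hc
        (hbound x _ fun _ => hs)
    · rw [← hspec₀]
      exact (gap_dichotomy hHS hHsa hHS' hH'sa hc hbound ha hb hab).imp (fun h => h x)
        fun h => h x
end

section
/- Assume additionally that X is connected. Then for every E ∈ ℝ: E ∉ Σ₁ if and only if either the set E − S is contained in a gap of Σ₀, or Σ₀ is contained in a gap of E − S. -/
open MeasureTheory Topology
open scoped Pointwise ENNReal

/-- `ContainedInGap K A` says that the set `A` is contained in a single gap of `K`, i.e. in one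
connected component of the complement `ℝ \ K`. -/
def ContainedInGap (K A : Set ℝ) : Prop :=
  ∃ x ∈ Kᶜ, A ⊆ connectedComponentIn Kᶜ x

open Filter

section SelfAdjoint

open scoped InnerProductSpace

variable {F : Type*} [NormedAddCommGroup F] [InnerProductSpace ℝ F] [CompleteSpace F]

lemma inner_map_comm_of_isSelfAdjoint {Q : F →L[ℝ] F} (hQ : IsSelfAdjoint Q) (x y : F) :
    ⟪Q x, y⟫_ℝ = ⟪x, Q y⟫_ℝ :=
  hQ.isSymmetric x y

/-- An invertible positive semidefinite operator is bounded below as a quadratic form. -/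
lemma exists_pos_mul_sq_le_inner_of_isUnit {Q : F →L[ℝ] F} (hQ : IsSelfAdjoint Q)
    (hpos : ∀ ψ, 0 ≤ ⟪Q ψ, ψ⟫_ℝ) (hu : IsUnit Q) :
    ∃ c > 0, ∀ ψ, c * ‖ψ‖ ^ 2 ≤ ⟪Q ψ, ψ⟫_ℝ := by
  obtain ⟨u, rfl⟩ := hu
  set Q : F →L[ℝ] F := ↑u
  set R : F →L[ℝ] F := ↑u⁻¹
  have hRQ : ∀ ψ, R (Q ψ) = ψ := fun ψ => by
    exact congrArg (fun A : F →L[ℝ] F => A ψ) u.inv_mul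
  set s : ℝ := (‖Q‖ + 1)⁻¹
  have hs : 0 < s := by positivity
  have hs1 : s * (‖Q‖ + 1) = 1 := inv_mul_cancel₀ (by positivity)
  have key : ∀ ψ, s * ‖Q ψ‖ ^ 2 ≤ ⟪Q ψ, ψ⟫_ℝ := by
    intro ψ
    have h1 := hpos (ψ - s • Q ψ)
    have h2 : ⟪Q (Q ψ), ψ⟫_ℝ = ‖Q ψ‖ ^ 2 := by
      rw [inner_map_comm_of_isSelfAdjoint hQ, real_inner_self_eq_norm_sq]
    have h3 : ⟪Q (Q ψ), Q ψ⟫_ℝ ≤ ‖Q‖ * ‖Q ψ‖ ^ 2 := by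
      refine (real_inner_le_norm _ _).trans ?_
      nlinarith [Q.le_opNorm (Q ψ), norm_nonneg (Q ψ)]
    simp only [map_sub, map_smul, inner_sub_left, inner_sub_right, inner_smul_left,
      inner_smul_right, h2, real_inner_self_eq_norm_sq, RCLike.conj_to_real] at h1
    have h4 : s * (s * ⟪Q (Q ψ), Q ψ⟫_ℝ) ≤ s * (s * (‖Q‖ * ‖Q ψ‖ ^ 2)) := by gcongr
    have h5 : s * (s * (‖Q‖ * ‖Q ψ‖ ^ 2)) = s * ‖Q ψ‖ ^ 2 - s * s * ‖Q ψ‖ ^ 2 := by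
      linear_combination s * ‖Q ψ‖ ^ 2 * hs1
    nlinarith [mul_nonneg (mul_nonneg hs.le hs.le) (sq_nonneg ‖Q ψ‖)]
  refine ⟨s * ((‖R‖ + 1) ^ 2)⁻¹, by positivity, fun ψ => le_trans ?_ (key ψ)⟩
  rw [mul_assoc]
  refine mul_le_mul_of_nonneg_left ?_ hs.le
  rw [inv_mul_le_iff₀ (by positivity), ← mul_pow]
  refine pow_le_pow_left₀ (norm_nonneg _) ?_ 2
  calc ‖ψ‖ = ‖R (Q ψ)‖ := by rw [hRQ]
    _ ≤ ‖R‖ * ‖Q ψ‖ := R.le_opNorm _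
    _ ≤ (‖R‖ + 1) * ‖Q ψ‖ := by gcongr; linarith

omit [CompleteSpace F] in
lemma isUnit_mul_self_sub_of_notMem_spectrum {B : F →L[ℝ] F} {m : ℝ}
    (h1 : m ∉ spectrum ℝ B) (h2 : -m ∉ spectrum ℝ B) :
    IsUnit (B * B - algebraMap ℝ (F →L[ℝ] F) (m ^ 2)) := by
  rw [spectrum.notMem_iff] at h1 h2
  have h := h1.mul h2
  convert h.neg.neg using 1
  have hc := Algebra.commutes m B
  simp only [map_neg, map_pow]
  noncomm_ring
  rw [hc]
  abel

lemma inner_mul_self_sub_algebraMap {B : F →L[ℝ] F} (hB : IsSelfAdjoint B) (c : ℝ) (ψ : F) :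
    ⟪(B * B - algebraMap ℝ (F →L[ℝ] F) c) ψ, ψ⟫_ℝ = ‖B ψ‖ ^ 2 - c * ‖ψ‖ ^ 2 := by
  simp only [_root_.sub_apply, mul_apply_eq_comp, inner_sub_left,
    inner_map_comm_of_isSelfAdjoint hB (B ψ), real_inner_self_eq_norm_sq,
    Algebra.algebraMap_eq_smul_one, _root_.smul_apply, one_apply_eq_self,
    inner_smul_left, RCLike.conj_to_real]

lemma isSelfAdjoint_mul_self_sub_algebraMap {B : F →L[ℝ] F} (hB : IsSelfAdjoint B) (c : ℝ) :
    IsSelfAdjoint (B * B - algebraMap ℝ (F →L[ℝ] F) c) :=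
  (by simpa [pow_two] using hB.pow 2 : IsSelfAdjoint (B * B)).sub
    (IsSelfAdjoint.algebraMap _ (IsSelfAdjoint.all c))

/-- A self-adjoint operator with no spectrum in `(-δ, δ)` is bounded below by `δ`. -/
lemma le_norm_map_of_forall_notMem_spectrum {B : F →L[ℝ] F} (hB : IsSelfAdjoint B) {δ : ℝ}
    (hδ : 0 ≤ δ) (h : ∀ z, |z| < δ → z ∉ spectrum ℝ B) (ψ : F) : δ * ‖ψ‖ ≤ ‖B ψ‖ := by
  set C : Set ℝ := Set.Icc 0 δ ∩ ⋂ ψ : F, {c | c * ‖ψ‖ ≤ ‖B ψ‖}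
  have hC : IsCompact C := by
    refine isCompact_Icc.inter_right (isClosed_iInter fun ψ => ?_)
    exact isClosed_le (by fun_prop) continuous_const
  obtain ⟨m, ⟨hm, hmψ⟩, hmax⟩ := hC.exists_isGreatest ⟨0, ⟨le_rfl, hδ⟩, by simp⟩
  simp only [Set.mem_iInter, Set.mem_ofPred_eq] at hmψ
  rcases hm.2.eq_or_lt with rfl | hlt
  · exact hmψ ψ
  exfalso
  have hu := isUnit_mul_self_sub_of_notMem_spectrum (B := B) (m := m)
    (h m (by rwa [abs_of_nonneg hm.1])) (h (-m) (by rwa [abs_neg, abs_of_nonneg hm.1]))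
  obtain ⟨c, hc, hcψ⟩ := exists_pos_mul_sq_le_inner_of_isUnit
    (isSelfAdjoint_mul_self_sub_algebraMap hB _) (fun φ => by
      rw [inner_mul_self_sub_algebraMap hB, ← mul_pow, sub_nonneg]
      exact pow_le_pow_left₀ (mul_nonneg hm.1 (norm_nonneg _)) (hmψ φ) 2) hu
  have hmem : min δ (√(m ^ 2 + c)) ∈ C := by
    refine ⟨⟨by positivity, min_le_left _ _⟩, ?_⟩
    simp only [Set.mem_iInter, Set.mem_ofPred_eq]
    intro φ
    refine (mul_le_mul_of_nonneg_right (min_le_right _ _) (norm_nonneg _)).trans ?_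
    refine abs_le_of_sq_le_sq' ?_ (norm_nonneg _) |>.2
    rw [mul_pow, Real.sq_sqrt (by positivity)]
    have := hcψ φ
    rw [inner_mul_self_sub_algebraMap hB] at this
    linarith
  have := hmax hmem
  have h2 : m < √(m ^ 2 + c) := Real.lt_sqrt_of_sq_lt (by linarith)
  exact absurd this (not_le.2 (lt_min hlt h2))

/-- A self-adjoint operator with spectrum in `[-r, r]` is bounded by `r`. -/
lemma norm_map_le_of_spectrum_subset {B : F →L[ℝ] F} (hB : IsSelfAdjoint B) {r : ℝ}
    (h : ∀ z ∈ spectrum ℝ B, |z| ≤ r) (hr : 0 ≤ r) (ψ : F) : ‖B ψ‖ ≤ r * ‖ψ‖ := by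
  refine (B.le_opNorm ψ).trans (mul_le_mul_of_nonneg_right ?_ (norm_nonneg _))
  by_contra! hlt
  set m := ‖B‖
  have hm : 0 ≤ m := norm_nonneg _
  have hu := isUnit_mul_self_sub_of_notMem_spectrum (B := B) (m := m)
    (fun hz => by have := h _ hz; rw [abs_of_nonneg hm] at this; linarith)
    (fun hz => by have := h _ hz; rw [abs_neg, abs_of_nonneg hm] at this; linarith)
  obtain ⟨c, hc, hcψ⟩ := exists_pos_mul_sq_le_inner_of_isUnit
    (isSelfAdjoint_mul_self_sub_algebraMap hB _).neg (fun φ => by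
      rw [_root_.neg_apply, inner_neg_left, inner_mul_self_sub_algebraMap hB,
        ← mul_pow, neg_sub, sub_nonneg]
      exact pow_le_pow_left₀ (norm_nonneg _) (B.le_opNorm φ) 2) hu.neg
  have hle : m ≤ √(m ^ 2 - c) := by
    refine B.opNorm_le_bound (Real.sqrt_nonneg _) fun φ => ?_
    have h1 := hcψ φ
    rw [_root_.neg_apply, inner_neg_left, inner_mul_self_sub_algebraMap hB] at h1
    rw [← Real.sqrt_sq (norm_nonneg (B φ)), ← Real.sqrt_sq (norm_nonneg φ), ← Real.sqrt_mul']
    · apply Real.sqrt_le_sqrt; linarith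
    · positivity
  have : m < m := hle.trans_lt <| (Real.sqrt_lt' (hr.trans_lt hlt)).2 (by linarith)
  exact lt_irrefl _ this

/-- A self-adjoint operator that is bounded below is invertible. -/
lemma isUnit_of_le_norm_map {B : F →L[ℝ] F} (hB : IsSelfAdjoint B) {c : ℝ} (hc : 0 < c)
    (h : ∀ ψ, c * ‖ψ‖ ≤ ‖B ψ‖) : IsUnit B := by
  have h2 : IsUnit (B * B) := by
    refine ContinuousLinearMap.isUnit_of_forall_le_norm_inner_map (𝕜 := ℝ) _
      (c := (c ^ 2).toNNReal) (by simpa using pow_pos hc 2) fun ψ => ?_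
    rw [mul_apply_eq_comp, inner_map_comm_of_isSelfAdjoint hB,
      real_inner_self_eq_norm_sq, Real.norm_of_nonneg (by positivity), Real.coe_toNNReal _ (sq_nonneg c), mul_comm,
      ← mul_pow]
    exact pow_le_pow_left₀ (by positivity) (h ψ) 2
  exact (Commute.isUnit_mul_iff (Commute.refl B)).1 h2 |>.1

lemma isSelfAdjoint_sub_algebraMap {B : F →L[ℝ] F} (hB : IsSelfAdjoint B) (c : ℝ) :
    IsSelfAdjoint (B - algebraMap ℝ (F →L[ℝ] F) c) :=
  hB.sub (IsSelfAdjoint.algebraMap _ (IsSelfAdjoint.all c))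

omit [CompleteSpace F] in
lemma sub_algebraMap_apply_s2 (B : F →L[ℝ] F) (c : ℝ) (ψ : F) :
    (B - algebraMap ℝ (F →L[ℝ] F) c) ψ = B ψ - c • ψ := by
  simp [Algebra.algebraMap_eq_smul_one]

omit [CompleteSpace F] in
lemma mem_spectrum_sub_algebraMap {B : F →L[ℝ] F} {c z : ℝ} :
    z ∈ spectrum ℝ (B - algebraMap ℝ (F →L[ℝ] F) c) ↔ z + c ∈ spectrum ℝ B := by
  rw [spectrum.mem_iff, spectrum.mem_iff, map_add]
  rw [show algebraMap ℝ (F →L[ℝ] F) z - (B - algebraMap ℝ (F →L[ℝ] F) c)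
    = algebraMap ℝ (F →L[ℝ] F) z + algebraMap ℝ (F →L[ℝ] F) c - B by abel]

lemma le_norm_sub_smul_of_spectrum {B : F →L[ℝ] F} (hB : IsSelfAdjoint B) {c δ : ℝ}
    (hδ : 0 ≤ δ) (h : ∀ z, |z - c| < δ → z ∉ spectrum ℝ B) (ψ : F) :
    δ * ‖ψ‖ ≤ ‖B ψ - c • ψ‖ := by
  rw [← sub_algebraMap_apply_s2]
  refine le_norm_map_of_forall_notMem_spectrum (isSelfAdjoint_sub_algebraMap hB c) hδ ?_ ψ
  intro z hz hmem
  exact h (z + c) (by simpa using hz) (mem_spectrum_sub_algebraMap.1 hmem)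

lemma norm_sub_smul_le_of_spectrum {B : F →L[ℝ] F} (hB : IsSelfAdjoint B) {c r : ℝ}
    (h : ∀ z ∈ spectrum ℝ B, |z - c| ≤ r) (hr : 0 ≤ r) (ψ : F) :
    ‖B ψ - c • ψ‖ ≤ r * ‖ψ‖ := by
  rw [← sub_algebraMap_apply_s2]
  refine norm_map_le_of_spectrum_subset (isSelfAdjoint_sub_algebraMap hB c) ?_ hr ψ
  intro z hmem
  simpa using h (z + c) (mem_spectrum_sub_algebraMap.1 hmem)

lemma isUnit_sub_algebraMap_of_le_norm {B : F →L[ℝ] F} (hB : IsSelfAdjoint B) {c δ : ℝ}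
    (hδ : 0 < δ) (h : ∀ ψ, δ * ‖ψ‖ ≤ ‖B ψ - c • ψ‖) :
    IsUnit (B - algebraMap ℝ (F →L[ℝ] F) c) :=
  isUnit_of_le_norm_map (isSelfAdjoint_sub_algebraMap hB c) hδ fun ψ => by
    rw [sub_algebraMap_apply_s2]; exact h ψ

lemma notMem_spectrum_of_le_norm {B : F →L[ℝ] F} (hB : IsSelfAdjoint B) {c δ : ℝ}
    (hδ : 0 < δ) (h : ∀ ψ, δ * ‖ψ‖ ≤ ‖B ψ - c • ψ‖) : c ∉ spectrum ℝ B := by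
  rw [spectrum.notMem_iff, ← neg_sub]
  exact (isUnit_sub_algebraMap_of_le_norm hB hδ h).neg

/-- Weyl's criterion. -/
lemma exists_norm_sub_smul_lt_of_mem_spectrum {B : F →L[ℝ] F} (hB : IsSelfAdjoint B) {c : ℝ}
    (hc : c ∈ spectrum ℝ B) {ε : ℝ} (hε : 0 < ε) : ∃ ψ, ‖B ψ - c • ψ‖ < ε * ‖ψ‖ := by
  by_contra! h
  exact notMem_spectrum_of_le_norm hB hε h hc

lemma spectrum_nonempty_of_isSelfAdjoint [Nontrivial F] {B : F →L[ℝ] F} (hB : IsSelfAdjoint B) :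
    (spectrum ℝ B).Nonempty := by
  by_contra! hne
  obtain ⟨ψ, hψ⟩ := exists_ne (0 : F)
  have h1 := le_norm_map_of_forall_notMem_spectrum hB zero_le_one (by simp [hne]) ψ
  have h2 := norm_map_le_of_spectrum_subset hB (by simp [hne]) le_rfl ψ
  have := norm_pos_iff.2 hψ
  linarith

/-- A self-adjoint operator whose form `⟨(B - a)ψ, ψ⟩ + ‖(B - a)ψ‖² / (a - b)` is semidefinite
of sign `s` satisfies the corresponding inequality on its spectrum. -/
lemma mul_nonneg_of_mem_spectrum {B : F →L[ℝ] F} (hB : IsSelfAdjoint B) {a t s z : ℝ}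
    (hform : ∀ ψ, 0 ≤ s * (⟪B ψ - a • ψ, ψ⟫_ℝ + t⁻¹ * ‖B ψ - a • ψ‖ ^ 2))
    (hz : z ∈ spectrum ℝ B) : 0 ≤ s * ((z - a) + t⁻¹ * (z - a) ^ 2) := by
  set τ := z - a
  have key : ∀ ε > 0, 0 ≤ s * (τ + t⁻¹ * τ ^ 2) +
      |s| * (ε + |t⁻¹| * (2 * |τ| * ε + ε ^ 2)) := by
    intro ε hε
    obtain ⟨ψ, hψ⟩ := exists_norm_sub_smul_lt_of_mem_spectrum hB hz hε
    have hψ0 : 0 < ‖ψ‖ := by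
      by_contra! h0
      have : ‖ψ‖ = 0 := le_antisymm h0 (norm_nonneg _)
      rw [this, mul_zero] at hψ
      exact absurd hψ (not_lt.2 (norm_nonneg _))
    set r := B ψ - z • ψ
    have hr : B ψ - a • ψ = τ • ψ + r := by simp only [τ, r, sub_smul]; abel
    have h1 := hform ψ
    rw [hr] at h1
    have h2 : ‖τ • ψ + r‖ ^ 2 = τ ^ 2 * ‖ψ‖ ^ 2 + 2 * τ * ⟪r, ψ⟫_ℝ + ‖r‖ ^ 2 := by
      rw [norm_add_sq_real, norm_smul, mul_pow, Real.norm_eq_abs, sq_abs, inner_smul_left,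
        real_inner_comm]
      simp only [RCLike.conj_to_real]; ring
    rw [h2, inner_add_left, inner_smul_left, real_inner_self_eq_norm_sq,
      RCLike.conj_to_real] at h1
    have h3 : |⟪r, ψ⟫_ℝ| ≤ ε * ‖ψ‖ ^ 2 :=
      (abs_real_inner_le_norm _ _).trans (by nlinarith)
    have h4 : ‖r‖ ^ 2 ≤ ε ^ 2 * ‖ψ‖ ^ 2 := by
      rw [← mul_pow]; exact pow_le_pow_left₀ (norm_nonneg _) hψ.le 2
    have h5 : s * (⟪r, ψ⟫_ℝ + t⁻¹ * (2 * τ * ⟪r, ψ⟫_ℝ + ‖r‖ ^ 2)) ≤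
        |s| * (ε + |t⁻¹| * (2 * |τ| * ε + ε ^ 2)) * ‖ψ‖ ^ 2 := by
      refine (le_abs_self _).trans ?_
      rw [abs_mul, mul_assoc |_|]
      refine mul_le_mul_of_nonneg_left ?_ (abs_nonneg _)
      refine (abs_add_le _ _).trans ?_
      rw [add_mul]
      refine add_le_add h3 ?_
      rw [abs_mul, mul_assoc |_|]
      refine mul_le_mul_of_nonneg_left ?_ (abs_nonneg _)
      refine (abs_add_le _ _).trans ?_
      rw [add_mul]
      refine add_le_add ?_ (by rwa [abs_of_nonneg (sq_nonneg ‖r‖)])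
      rw [abs_mul, abs_mul, abs_two, mul_assoc (2 * |τ|)]
      exact mul_le_mul_of_nonneg_left h3 (by positivity)
    have h6 : 0 ≤ (s * (τ + t⁻¹ * τ ^ 2) +
      |s| * (ε + |t⁻¹| * (2 * |τ| * ε + ε ^ 2))) * ‖ψ‖ ^ 2 := by
      rw [add_mul]; nlinarith
    exact nonneg_of_mul_nonneg_left h6 (by positivity)
  have hlim : Tendsto (fun ε : ℝ => s * (τ + t⁻¹ * τ ^ 2) +
      |s| * (ε + |t⁻¹| * (2 * |τ| * ε + ε ^ 2))) (𝓝[>] 0)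
      (𝓝 (s * (τ + t⁻¹ * τ ^ 2) + |s| * (0 + |t⁻¹| * (2 * |τ| * 0 + 0 ^ 2)))) :=
    (Continuous.tendsto (by fun_prop) 0).mono_left nhdsWithin_le_nhds
  have := ge_of_tendsto hlim (eventually_nhdsWithin_of_forall fun ε hε => key ε hε)
  simpa using this

end SelfAdjoint

section SequenceSpace

open scoped InnerProductSpace

/-- The Hilbert space `ℓ²(ℤ)` of real sequences. -/
abbrev EllTwo : Type := lp (fun _ : ℤ => ℝ) 2

namespace EllTwo

lemma summable_sq (v : EllTwo) : Summable fun k => (v k) ^ 2 := by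
  have := (memℓp_gen_iff (p := 2) (by simp)).1 v.2
  simpa using this

lemma memℓp_of_summable_sq {v : ℤ → ℝ} (h : Summable fun k => (v k) ^ 2) : Memℓp v 2 :=
  (memℓp_gen_iff (p := 2) (by simp)).2 (by simpa using h)

lemma norm_sq_eq_tsum (v : EllTwo) : ‖v‖ ^ 2 = ∑' k, (v k) ^ 2 := by
  have := lp.norm_rpow_eq_tsum (p := 2) (by simp) v
  simpa using this

lemma inner_eq_tsum_mul (v w : EllTwo) : ⟪v, w⟫_ℝ = ∑' k, v k * w k := by
  rw [lp.inner_eq_tsum]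
  exact tsum_congr fun k => by simp [mul_comm]

lemma norm_le_of_forall_abs_le {v w : EllTwo} (h : ∀ k, |v k| ≤ |w k|) : ‖v‖ ≤ ‖w‖ := by
  rw [← abs_of_nonneg (norm_nonneg v), ← abs_of_nonneg (norm_nonneg w), ← sq_le_sq,
    norm_sq_eq_tsum, norm_sq_eq_tsum]
  exact (summable_sq v).tsum_le_tsum (fun k => sq_le_sq.2 (h k)) (summable_sq w)

/-- Dominated convergence in `ℓ²(ℤ)`. -/
lemma tendsto_zero_of_dominated {ι : Type*} {l : Filter ι} {v : ι → EllTwo} (w : EllTwo)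
    (hle : ∀ i k, |v i k| ≤ |w k|) (hlim : ∀ k, Tendsto (fun i => v i k) l (𝓝 0)) :
    Tendsto v l (𝓝 0) := by
  rw [tendsto_zero_iff_norm_tendsto_zero]
  have h : Tendsto (fun i => ∑' k, (v i k) ^ 2) l (𝓝 (∑' _ : ℤ, 0)) := by
    refine tendsto_tsum_of_dominated_convergence (summable_sq w) (fun k => ?_)
      (Eventually.of_forall fun i k => ?_)
    · simpa using (hlim k).pow 2
    · rw [Real.norm_of_nonneg (sq_nonneg _)]
      exact sq_le_sq.2 (hle i k)
  rw [tsum_zero] at h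
  have h2 := h.sqrt
  simp only [← norm_sq_eq_tsum, Real.sqrt_sq (norm_nonneg _), Real.sqrt_zero] at h2
  exact h2

/-- The unit vector at the site `n`. -/
noncomputable abbrev basisVec (n : ℤ) : EllTwo := lp.single 2 n (1 : ℝ)

lemma basisVec_apply (n k : ℤ) : basisVec n k = if k = n then 1 else 0 := by
  simp [basisVec, Pi.single_apply]

lemma basisVec_ne_zero (n : ℤ) : basisVec n ≠ 0 := fun h => by
  have := congrArg (fun v : EllTwo => v n) h
  simp at this

instance : Nontrivial EllTwo := ⟨⟨basisVec 0, 0, basisVec_ne_zero 0⟩⟩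

end EllTwo

open EllTwo

/-- If all operators `K n = A + t χ_{(-∞, n)}` are uniformly invertible and the rank-one
increments `t⁻¹ + ⟨δ_n, (K n)⁻¹ δ_n⟩` all have the same sign, then the form
`⟨A h, h⟩ + t⁻¹ ‖A h‖²` is semidefinite with that sign. -/
lemma form_nonneg_of_increments_nonneg {A : EllTwo →L[ℝ] EllTwo} {K : ℤ → EllTwo →L[ℝ] EllTwo}
    {t δ s : ℝ} (ht : t ≠ 0) (hδ : 0 < δ) (hA : IsSelfAdjoint A) (hAu : IsUnit A)
    (hKA : ∀ n ψ k, (K n ψ) k = (A ψ) k + if k < n then t * ψ k else 0)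
    (hKδ : ∀ n ψ, δ * ‖ψ‖ ≤ ‖K n ψ‖) (hKu : ∀ n, IsUnit (K n))
    (u : ℤ → EllTwo) (hu : ∀ n, K n (u n) = basisVec n) (hs : ∀ n, 0 ≤ s * (t⁻¹ + u n n))
    (h : EllTwo) : 0 ≤ s * (⟪A h, h⟫_ℝ + t⁻¹ * ‖A h‖ ^ 2) := by
  have hKinj : ∀ n ψ φ, K n ψ = K n φ → ψ = φ := fun n ψ φ hψ => by
    have h1 := hKδ n (ψ - φ)
    rw [map_sub, sub_eq_zero.2 hψ, norm_zero] at h1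
    exact sub_eq_zero.1 (norm_le_zero_iff.1 (nonpos_of_mul_nonpos_right h1 hδ))
  have hKsurj : ∀ n z, ∃ ψ, K n ψ = z := fun n z => by
    obtain ⟨U, hU⟩ := hKu n
    refine ⟨(↑U⁻¹ : EllTwo →L[ℝ] EllTwo) z, ?_⟩
    rw [← hU]
    exact congrArg (fun B : EllTwo →L[ℝ] EllTwo => B z) U.mul_inv
  set P : ℤ → EllTwo →L[ℝ] EllTwo := fun n => t⁻¹ • (K n - A) with hP
  have hPapp : ∀ n ψ k, (P n ψ) k = if k < n then ψ k else 0 := fun n ψ k => by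
    have : (P n ψ) k = t⁻¹ * ((K n ψ) k - (A ψ) k) := rfl
    rw [this, hKA]
    split_ifs <;> simp [ht]
  -- the statement for vectors `A h` supported on a left half-line
  have half : ∀ N h, P N (A h) = A h → 0 ≤ s * (⟪A h, h⟫_ℝ + t⁻¹ * ‖A h‖ ^ 2) := by
    intro N h hN
    set z : EllTwo := h + t⁻¹ • A h with hz
    have hzapp : ∀ k, t * z k = t * h k + (A h) k := fun k => by
      have : z k = h k + t⁻¹ * (A h) k := rfl
      rw [this]; field_simp
    choose g hg using fun n => hKsurj n (t • P n z)
    have hAg : ∀ n k, (A (g n)) k = if k < n then t * (z k - g n k) else 0 := fun n k => by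
      have h1 := congrArg (fun v : EllTwo => v k) (hg n)
      have h2 : (t • P n z) k = t * (P n z) k := rfl
      simp only [hKA, h2, hPapp] at h1
      split_ifs at h1 ⊢ <;> linarith
    have hgN : g N = h := by
      refine hKinj N _ _ ?_
      rw [hg]
      ext k
      have h2 : (t • P N z) k = t * (P N z) k := rfl
      have h3 := congrArg (fun v : EllTwo => v k) hN
      simp only [hPapp] at h3
      rw [h2, hPapp, hKA]
      split_ifs at h3 ⊢
      · rw [hzapp]; ring
      · rw [← h3]; ring
    set q : ℤ → ℝ := fun n => s * (⟪A (g n), g n⟫_ℝ + t⁻¹ * ‖A (g n)‖ ^ 2) with hq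
    have hmono : Monotone q := by
      refine monotone_int_of_le_succ fun n => ?_
      set d := g (n + 1) - g n with hd
      have hdapp : ∀ k, d k = g (n + 1) k - g n k := fun k => rfl
      set c := t * (z n - g (n + 1) n) with hc
      have hAd : ∀ k, (A d) k = if k < n then -t * d k else if k = n then c else 0 := fun k => by
        have h1 : (A d) k = (A (g (n + 1))) k - (A (g n)) k := by rw [hd, map_sub]; rfl
        rw [h1, hAg, hAg, hdapp]
        rcases lt_trichotomy k n with hk | rfl | hk
        · rw [if_pos (by omega), if_pos hk, if_pos hk]; ring
        · simp [hc]
        · rw [if_neg (by omega), if_neg (by omega), if_neg (by omega), if_neg (by omega)]; ring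
      have hdu : d = c • u n := by
        refine hKinj n _ _ ?_
        rw [map_smul, hu]
        ext k
        have h2 : (c • basisVec n) k = c * basisVec n k := rfl
        rw [h2, hKA, hAd, basisVec_apply]
        rcases lt_trichotomy k n with hk | rfl | hk
        · rw [if_pos hk, if_pos hk, if_neg (by omega)]; ring
        · simp
        · rw [if_neg (by omega), if_neg (by omega), if_neg (by omega), if_neg (by omega)]; ring
      have hwapp : ∀ k, (d + t⁻¹ • A d) k = d k + t⁻¹ * (A d) k := fun k => rfl
      have h0 : ⟪A (g n), d + t⁻¹ • A d⟫_ℝ = 0 := by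
        rw [inner_eq_tsum_mul, ← tsum_zero (β := ℤ)]
        refine tsum_congr fun k => ?_
        rw [hwapp, hAg, hAd]
        split_ifs
        · field_simp; ring
        all_goals ring
      have h1 : ⟪A d, d + t⁻¹ • A d⟫_ℝ = c ^ 2 * (t⁻¹ + u n n) := by
        rw [inner_eq_tsum_mul, tsum_eq_single n]
        · have : d n = c * u n n := by rw [hdu]; rfl
          rw [hwapp, hAd, this]
          simp; ring
        · intro k hk
          rw [hwapp, hAd]
          rcases lt_or_gt_of_ne hk with hk | hk
          · rw [if_pos hk]; field_simp; ring
          · rw [if_neg (by omega), if_neg (by omega)]; ring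
      have hsum : g (n + 1) = g n + d := by rw [hd]; abel
      have h2 : q (n + 1) = q n + c ^ 2 * (s * (t⁻¹ + u n n)) := by
        simp only [inner_add_right, inner_smul_right, real_inner_self_eq_norm_sq] at h0 h1
        have h3 : ⟪A d, g n⟫_ℝ = ⟪A (g n), d⟫_ℝ := by
          rw [inner_map_comm_of_isSelfAdjoint hA, real_inner_comm]
        simp only [hq, hsum, map_add, inner_add_left, inner_add_right, norm_add_sq_real, h3]
        linear_combination 2 * s * h0 + s * h1
      rw [h2]
      nlinarith [mul_nonneg (sq_nonneg c) (hs n)]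
    have hPz : Tendsto (fun n => P n z) atBot (𝓝 0) := by
      refine tendsto_zero_of_dominated z (fun n k => ?_) (fun k => ?_)
      · rw [hPapp]; split_ifs <;> simp
      · refine tendsto_const_nhds.congr' ?_
        filter_upwards [eventually_le_atBot k] with n hn
        rw [hPapp, if_neg (by omega)]
    have hg0 : Tendsto g atBot (𝓝 0) := by
      refine squeeze_zero_norm (a := fun n => δ⁻¹ * (|t| * ‖P n z‖)) (fun n => ?_) ?_
      · rw [le_inv_mul_iff₀ hδ]
        refine (hKδ n _).trans ?_
        rw [hg, norm_smul, Real.norm_eq_abs]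
      · simpa using (hPz.norm.const_mul |t|).const_mul δ⁻¹
    have hq0 : Tendsto q atBot (𝓝 0) := by
      have hcont : Continuous fun h => s * (⟪A h, h⟫_ℝ + t⁻¹ * ‖A h‖ ^ 2) := by fun_prop
      have : Tendsto q atBot (𝓝 _) := (hcont.tendsto 0).comp hg0
      simpa using this
    have := hmono.le_of_tendsto hq0 N
    simpa only [hq, hgN] using this
  obtain ⟨U, rfl⟩ := hAu
  set A : EllTwo →L[ℝ] EllTwo := ↑U
  set R : EllTwo →L[ℝ] EllTwo := ↑U⁻¹
  have hRA : ∀ ψ, R (A ψ) = ψ := fun ψ =>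
    congrArg (fun B : EllTwo →L[ℝ] EllTwo => B ψ) U.inv_mul
  have hAR : ∀ ψ, A (R ψ) = ψ := fun ψ =>
    congrArg (fun B : EllTwo →L[ℝ] EllTwo => B ψ) U.mul_inv
  have hlim : Tendsto (fun n => P n (A h)) atTop (𝓝 (A h)) := by
    rw [tendsto_iff_norm_sub_tendsto_zero, ← tendsto_zero_iff_norm_tendsto_zero]
    have hsub : ∀ n k, (P n (A h) - A h) k = (P n (A h)) k - (A h) k := fun n k => rfl
    refine tendsto_zero_of_dominated (A h) (fun n k => ?_) (fun k => ?_)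
    · rw [hsub, hPapp]; split_ifs <;> simp
    · refine tendsto_const_nhds.congr' ?_
      filter_upwards [eventually_gt_atTop k] with n hn
      rw [hsub, hPapp, if_pos hn, sub_self]
  have hcont : Continuous fun v => s * (⟪v, R v⟫_ℝ + t⁻¹ * ‖v‖ ^ 2) := by fun_prop
  have := ge_of_tendsto' ((hcont.tendsto _).comp hlim) (b := 0) fun n => by
    have h1 := half n (R (P n (A h))) (by
      rw [hAR]
      ext k
      simp only [hPapp]
      split_ifs <;> rfl)
    rwa [hAR] at h1
  rwa [hRA] at this


/-- Convergence of bounded diagonal perturbations in the strong operator topology. -/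
lemma tendsto_apply_of_diagonal {ι : Type*} {l : Filter ι} {B : ι → EllTwo →L[ℝ] EllTwo}
    {B₀ : EllTwo →L[ℝ] EllTwo} {c : ι → ℤ → ℝ} {C : ℝ} {ψ : EllTwo}
    (hB : ∀ i k, (B i ψ) k - (B₀ ψ) k = c i k * ψ k) (hC : ∀ i k, |c i k| ≤ C)
    (hc : ∀ k, Tendsto (fun i => c i k) l (𝓝 0)) :
    Tendsto (fun i => B i ψ) l (𝓝 (B₀ ψ)) := by
  rw [tendsto_iff_norm_sub_tendsto_zero, ← tendsto_zero_iff_norm_tendsto_zero]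
  have hsub : ∀ i k, (B i ψ - B₀ ψ) k = c i k * ψ k := fun i k => hB i k
  refine tendsto_zero_of_dominated (C • ψ) (fun i k => ?_) (fun k => ?_)
  · have h1 : (C • ψ) k = C * ψ k := rfl
    rw [hsub, h1, abs_mul, abs_mul]
    exact mul_le_mul_of_nonneg_right ((hC i k).trans (le_abs_self C)) (abs_nonneg _)
  · simp only [hsub]
    simpa using (hc k).mul_const (ψ k)

lemma continuous_coe_toEquiv_zpow {X : Type*} [TopologicalSpace X] (T : X ≃ₜ X) (k : ℤ) :
    Continuous fun x => (T.toEquiv ^ k) x := by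
  have hnat : ∀ (e : X ≃ₜ X) (m : ℕ), Continuous fun x => (e.toEquiv ^ m) x := by
    intro e m
    induction m with
    | zero => exact continuous_id
    | succ m ih =>
      simp only [pow_succ, Equiv.Perm.mul_apply]
      exact ih.comp e.continuous
  obtain ⟨m, rfl | rfl⟩ := k.eq_nat_or_neg
  · simpa using hnat T m
  · have := hnat T.symm m
    have h2 : T.symm.toEquiv = T.toEquiv⁻¹ := rfl
    simpa [h2, zpow_neg, ← inv_pow] using this

/-- Over a connected hull, the rank-one increments of the Green function of the operators with
step potential `s₂ χ_{(-∞, n)} + s₁ χ_{[n, ∞)}` all have the same sign. -/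
lemma exists_sign_of_green_increments {X : Type*} [TopologicalSpace X] [CompactSpace X]
    [ConnectedSpace X] (T : X ≃ₜ X) (f : C(X, ℝ)) {E s₁ s₂ δ : ℝ} (hs : s₁ ≠ s₂) (hδ : 0 < δ)
    {K : X → ℤ → EllTwo →L[ℝ] EllTwo}
    (hK : ∀ x n ψ k, (K x n ψ) k = ψ (k + 1) + ψ (k - 1)
      + (f ((T.toEquiv ^ k) x) + if k < n then s₂ else s₁) * ψ k - E * ψ k)
    (hKδ : ∀ x n ψ, δ * ‖ψ‖ ≤ ‖K x n ψ‖) (hKu : ∀ x n, IsUnit (K x n)) :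
    ∃ s : ℝ, s ≠ 0 ∧ ∀ x n u, K x n u = basisVec n → 0 ≤ s * ((s₂ - s₁)⁻¹ + u n) := by
  have ht : s₂ - s₁ ≠ 0 := sub_ne_zero.2 hs.symm
  have hKinj : ∀ x n ψ φ, K x n ψ = K x n φ → ψ = φ := fun x n ψ φ hψ => by
    have h1 := hKδ x n (ψ - φ)
    rw [map_sub, sub_eq_zero.2 hψ, norm_zero] at h1
    exact sub_eq_zero.1 (norm_le_zero_iff.1 (nonpos_of_mul_nonpos_right h1 hδ))
  have hsol : ∀ x, ∃ ψ, K x 0 ψ = basisVec 0 := fun x => by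
    obtain ⟨U, hU⟩ := hKu x 0
    refine ⟨(↑U⁻¹ : EllTwo →L[ℝ] EllTwo) (basisVec 0), ?_⟩
    rw [← hU]
    exact congrArg (fun B : EllTwo →L[ℝ] EllTwo => B (basisVec 0)) U.mul_inv
  choose u hu using hsol
  have hucont : Continuous u := by
    rw [continuous_iff_continuousAt]
    intro x
    rw [ContinuousAt, tendsto_iff_norm_sub_tendsto_zero]
    have hlim : Tendsto (fun y => K y 0 (u x)) (𝓝 x) (𝓝 (K x 0 (u x))) := by
      refine tendsto_apply_of_diagonal (C := 2 * ‖f‖)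
        (c := fun y k => f ((T.toEquiv ^ k) y) - f ((T.toEquiv ^ k) x)) (fun y k => ?_)
        (fun y k => ?_) (fun k => ?_)
      · rw [hK, hK]; ring
      · have h1 := f.norm_coe_le_norm ((T.toEquiv ^ k) y)
        have h2 := f.norm_coe_le_norm ((T.toEquiv ^ k) x)
        rw [Real.norm_eq_abs] at h1 h2
        exact (abs_sub _ _).trans (by linarith)
      · have hc := (f.continuous.comp (continuous_coe_toEquiv_zpow T k)).tendsto x
        simpa using hc.sub_const (f ((T.toEquiv ^ k) x))
    have h0 : Tendsto (fun y => δ⁻¹ * ‖K y 0 (u x) - K x 0 (u x)‖) (𝓝 x) (𝓝 0) := by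
      simpa using (tendsto_iff_norm_sub_tendsto_zero.1 hlim).const_mul δ⁻¹
    refine squeeze_zero (fun _ => norm_nonneg _) (fun y => ?_) h0
    rw [le_inv_mul_iff₀ hδ]
    refine (hKδ y 0 _).trans (le_of_eq ?_)
    rw [map_sub, hu, hu, norm_sub_rev]
  set g : X → ℝ := fun x => (s₂ - s₁)⁻¹ + u x 0 with hg
  have hgcont : Continuous g := by
    refine continuous_const.add ?_
    have : (fun x => u x 0) = fun x => ⟪basisVec 0, u x⟫_ℝ := by
      funext x
      rw [lp.inner_single_left]
      simp
    rw [this]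
    fun_prop
  have hg0 : ∀ x, g x ≠ 0 := by
    intro x hx
    have h1 : K x 1 (u x) = K x 1 0 := by
      rw [map_zero]
      ext k
      have h2 := congrArg (fun v : EllTwo => v k) (hu x)
      simp only [hK, basisVec_apply] at h2
      have h4 : (0 : EllTwo) k = 0 := rfl
      rw [hK, h4]
      rcases eq_or_ne k 0 with rfl | hk
      · have h3 : (s₂ - s₁) * g x = 1 + (s₂ - s₁) * u x 0 := by
          simp only [hg]; field_simp
        rw [hx, mul_zero] at h3
        simp only [lt_irrefl, if_false, if_true, zero_lt_one] at h2 ⊢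
        linarith
      · have hiff : (k < 1) ↔ (k < 0) := by omega
        simp only [if_neg hk] at h2
        simp only [hiff]
        exact h2
    have h2 := hKinj _ _ _ _ h1
    have h3 := hu x
    rw [h2, map_zero] at h3
    exact basisVec_ne_zero 0 h3.symm
  have hshift : ∀ x n (v : EllTwo), K x n v = basisVec n → v n = u ((T.toEquiv ^ n) x) 0 := by
    intro x n v hv
    have hsum : Summable fun k => (v (k + n)) ^ 2 :=
      (summable_sq v).comp_injective (add_left_injective n)
    let w : EllTwo := ⟨fun k => v (k + n), memℓp_of_summable_sq hsum⟩
    have hw : ∀ k, w k = v (k + n) := fun k => rfl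
    have : w = u ((T.toEquiv ^ n) x) := by
      refine hKinj ((T.toEquiv ^ n) x) 0 _ _ ?_
      rw [hu]
      ext k
      have h2 := congrArg (fun v : EllTwo => v (k + n)) hv
      simp only [hK, basisVec_apply] at h2
      have hT : (T.toEquiv ^ k) ((T.toEquiv ^ n) x) = (T.toEquiv ^ (k + n)) x := by
        rw [zpow_add, Equiv.Perm.mul_apply]
      rw [hK, hT, basisVec_apply]
      have e1 : k + 1 + n = k + n + 1 := by ring
      have e2 : k - 1 + n = k + n - 1 := by ring
      have e3 : (k < 0) ↔ (k + n < n) := by omega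
      have e4 : (k = 0) ↔ (k + n = n) := by omega
      simp only [hw, e1, e2, e3, e4]
      exact h2
    rw [← this, hw, zero_add]
  by_cases hpos : ∃ x, 0 ≤ g x
  · refine ⟨1, one_ne_zero, fun x n v hv => ?_⟩
    rw [hshift x n v hv, one_mul]
    by_contra! hneg
    obtain ⟨y, hy⟩ := mem_range_of_exists_le_of_exists_ge hgcont
      ⟨(T.toEquiv ^ n) x, hneg.le⟩ hpos
    exact hg0 y hy
  · push Not at hpos
    refine ⟨-1, by norm_num, fun x n v hv => ?_⟩
    rw [hshift x n v hv]
    have := hpos ((T.toEquiv ^ n) x)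
    simp only [hg] at this
    linarith

end SequenceSpace

section Gaps

lemma exists_hull_of_containedInGap {K A : Set ℝ} (hK : IsClosed K) (hA : IsCompact A)
    (hne : A.Nonempty) (h : ContainedInGap K A) :
    ∃ p q ε, 0 < ε ∧ p ≤ q ∧ A ⊆ Set.Icc p q ∧ ∀ z, p - ε < z → z < q + ε → z ∉ K := by
  obtain ⟨x, hx, hsub⟩ := h
  have hp := hA.sInf_mem hne
  have hq := hA.sSup_mem hne
  have hpq : sInf A ≤ sSup A := csInf_le_csSup hne hA.bddBelow hA.bddAbove
  have hIcc : Set.Icc (sInf A) (sSup A) ⊆ Kᶜ :=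
    (isPreconnected_connectedComponentIn.ordConnected.out (hsub hp) (hsub hq)).trans
      (connectedComponentIn_subset _ _)
  obtain ⟨ε, hε, hεsub⟩ := isCompact_Icc.exists_thickening_subset_open hK.isOpen_compl hIcc
  refine ⟨sInf A, sSup A, ε, hε, hpq,
    fun a ha => ⟨csInf_le hA.bddBelow ha, le_csSup hA.bddAbove ha⟩, fun z h1 h2 => ?_⟩
  apply hεsub
  rw [Metric.mem_thickening_iff]
  refine ⟨max (sInf A) (min z (sSup A)), ⟨le_max_left _ _, max_le hpq (min_le_right _ _)⟩, ?_⟩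
  rw [Real.dist_eq, abs_lt]
  rcases le_total z (sSup A) with h3 | h3 <;> rcases le_total z (sInf A) with h4 | h4 <;>
    simp [h3, h4, hpq] <;> (try constructor) <;> linarith

lemma exists_between_of_not_containedInGap {K A : Set ℝ} (hd : Disjoint A K) (hne : A.Nonempty)
    (h : ¬ ContainedInGap K A) : ∃ a₁ ∈ A, ∃ a₂ ∈ A, ∃ b ∈ K, a₁ < b ∧ b < a₂ := by
  by_contra! hno
  obtain ⟨a, ha⟩ := hne
  have hAK : ∀ z ∈ A, z ∉ K := fun z hz => Set.disjoint_left.1 hd hz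
  refine h ⟨a, hAK a ha, fun a' ha' => ?_⟩
  refine isPreconnected_uIcc.subset_connectedComponentIn Set.left_mem_uIcc (fun b hb hbK => ?_)
    Set.right_mem_uIcc
  have h1 : b ≠ a := fun hba => hAK a ha (hba ▸ hbK)
  have h2 : b ≠ a' := fun hba => hAK a' ha' (hba ▸ hbK)
  rcases Set.mem_uIcc.1 hb with ⟨h3, h4⟩ | ⟨h3, h4⟩
  · exact absurd (hno a ha a' ha' b hbK (lt_of_le_of_ne h3 h1.symm))
      (not_le.2 (lt_of_le_of_ne h4 h2))
  · exact absurd (hno a' ha' a ha b hbK (lt_of_le_of_ne h3 h2.symm))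
      (not_le.2 (lt_of_le_of_ne h4 h1))

/-- Two disjoint sets neither of which lies in a gap of the other one interlace. -/
lemma exists_interlacing {A B : Set ℝ} (hd : Disjoint A B) (hA : A.Nonempty) (hB : B.Nonempty)
    (hAB : ¬ ContainedInGap B A) (hBA : ¬ ContainedInGap A B) :
    ∃ a₁ ∈ A, ∃ a₂ ∈ A, ∃ b ∈ B, ∃ b' ∈ B, a₁ < b ∧ b < a₂ ∧ (b' < a₁ ∨ a₂ < b') := by
  obtain ⟨a₁, ha₁, a₂, ha₂, b, hb, h1, h2⟩ := exists_between_of_not_containedInGap hd hA hAB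
  obtain ⟨b₁, hb₁, b₂, hb₂, a, ha, h3, h4⟩ :=
    exists_between_of_not_containedInGap hd.symm hB hBA
  have hne : ∀ y ∈ A, ∀ z ∈ B, y ≠ z := fun y hy z hz hyz =>
    Set.disjoint_left.1 hd hy (hyz ▸ hz)
  rcases lt_or_gt_of_ne (hne a₁ ha₁ b₁ hb₁) with h5 | h5
  · rcases lt_or_gt_of_ne (hne a₂ ha₂ b₂ hb₂) with h6 | h6
    · exact ⟨a₁, ha₁, a₂, ha₂, b, hb, b₂, hb₂, h1, h2, Or.inr h6⟩
    · exact ⟨a₁, ha₁, a, ha, b₁, hb₁, b₂, hb₂, h5, h3, Or.inr h4⟩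
  · exact ⟨a₁, ha₁, a₂, ha₂, b, hb, b₁, hb₁, h1, h2, Or.inl h5⟩

end Gaps

section ProductMeasure

lemma measure_compl_eq_zero_of_eq_support {ν : Measure ℝ} {S : Set ℝ}
    (hS : S = {v : ℝ | ∀ U ∈ 𝓝 v, ν U ≠ 0}) : ν Sᶜ = 0 := by
  refine measure_null_of_locally_null _ fun v hv => ?_
  rw [hS] at hv
  simp only [Set.mem_compl_iff, Set.mem_ofPred_eq, not_forall, not_not] at hv
  obtain ⟨U, hU, hU0⟩ := hv
  exact ⟨U, mem_nhdsWithin_of_mem_nhds hU, hU0⟩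

lemma ae_forall_mem_of_product {ν : Measure ℝ} {S : Set ℝ}
    (hS : S = {v : ℝ | ∀ U ∈ 𝓝 v, ν U ≠ 0}) (hSc : IsClosed S) {ν' : Measure (ℤ → ℝ)}
    (hν' : ∀ (F : Finset ℤ) (t : ℤ → Set ℝ), (∀ i, MeasurableSet (t i)) →
      ν' {ω | ∀ i ∈ F, ω i ∈ t i} = ∏ i ∈ F, ν (t i)) :
    ∀ᵐ ω ∂ν', ∀ n, ω n ∈ S := by
  rw [ae_all_iff]
  intro n
  have h := hν' {n} (fun _ => Sᶜ) (fun _ => hSc.measurableSet.compl)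
  simp only [Finset.mem_singleton, forall_eq, Finset.prod_singleton,
    measure_compl_eq_zero_of_eq_support hS] at h
  exact h

/-- Points of a set of full measure approximate every `(x, ω)` on every finite window. -/
lemma exists_mem_near_of_ae {X : Type*} [TopologicalSpace X] [MeasurableSpace X] (T : X ≃ₜ X)
    {μ : Measure X} (hfull : ∀ U : Set X, IsOpen U → U.Nonempty → μ U ≠ 0) (f : C(X, ℝ))
    {ν : Measure ℝ} {S : Set ℝ} (hS : S = {v : ℝ | ∀ U ∈ 𝓝 v, ν U ≠ 0})
    {ν' : Measure (ℤ → ℝ)} [SFinite ν']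
    (hν' : ∀ (F : Finset ℤ) (t : ℤ → Set ℝ), (∀ i, MeasurableSet (t i)) →
      ν' {ω | ∀ i ∈ F, ω i ∈ t i} = ∏ i ∈ F, ν (t i))
    {p : X × (ℤ → ℝ) → Prop} (hp : ∀ᵐ y ∂(μ.prod ν'), p y) (x : X) {ω : ℤ → ℝ}
    (hω : ∀ n, ω n ∈ S) (F : Finset ℤ) {η : ℝ} (hη : 0 < η) :
    ∃ y, p y ∧ ∀ k ∈ F, |f ((T.toEquiv ^ k) y.1) - f ((T.toEquiv ^ k) x)| < η ∧
      |y.2 k - ω k| < η := by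
  set U : Set X := ⋂ k ∈ F, {y | |f ((T.toEquiv ^ k) y) - f ((T.toEquiv ^ k) x)| < η} with hU
  set V : Set (ℤ → ℝ) := {ω' | ∀ i ∈ F, ω' i ∈ Metric.ball (ω i) η} with hV
  have hUo : IsOpen U := isOpen_biInter_finset fun k _ => by
    have hc := f.continuous.comp (continuous_coe_toEquiv_zpow T k)
    exact isOpen_lt (hc.sub continuous_const).abs continuous_const
  have hU0 : μ U ≠ 0 := hfull U hUo ⟨x, by simp [hU, hη]⟩
  have hV0 : ν' V ≠ 0 := by
    rw [hV, hν' F (fun i => Metric.ball (ω i) η) fun i => measurableSet_ball, Finset.prod_ne_zero_iff]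
    intro i _
    have := hω i
    rw [hS] at this
    exact this _ (Metric.ball_mem_nhds _ hη)
  have hUV : (μ.prod ν') (U ×ˢ V) ≠ 0 := by
    rw [Measure.prod_prod]
    exact mul_ne_zero hU0 hV0
  obtain ⟨y, hy, hpy⟩ := ((frequently_ae_mem_iff.2 hUV).and_eventually hp).exists
  refine ⟨y, hpy, fun k hk => ⟨?_, ?_⟩⟩
  · have := hy.1
    simp only [hU, Set.mem_iInter] at this
    exact this k hk
  · have := hy.2 k hk
    rwa [Metric.mem_ball, Real.dist_eq] at this

end ProductMeasure

/-- If `E` lies outside the almost sure spectrum of `H_{x, ω}`, then all operators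
`H_{x, ω} - E` are bounded below by the same positive constant. -/
lemma exists_uniform_lower_bound {X : Type*} [TopologicalSpace X] [CompactSpace X]
    [MeasurableSpace X] (T : X ≃ₜ X) {μ : Measure X}
    (hfull : ∀ U : Set X, IsOpen U → U.Nonempty → μ U ≠ 0) (f : C(X, ℝ))
    {ν : Measure ℝ} {S : Set ℝ} (hS : S = {v : ℝ | ∀ U ∈ 𝓝 v, ν U ≠ 0}) (hScompact : IsCompact S)
    {ν' : Measure (ℤ → ℝ)} [SFinite ν']
    (hν' : ∀ (F : Finset ℤ) (t : ℤ → Set ℝ), (∀ i, MeasurableSet (t i)) →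
      ν' {ω | ∀ i ∈ F, ω i ∈ t i} = ∏ i ∈ F, ν (t i))
    {H' : X → (ℤ → ℝ) → (EllTwo →L[ℝ] EllTwo)}
    (hH' : ∀ (x : X) (ω : ℤ → ℝ), (∀ n, ω n ∈ S) → ∀ (ψ : EllTwo) (n : ℤ),
      (H' x ω ψ) n = ψ (n + 1) + ψ (n - 1) + (f ((T.toEquiv ^ n) x) + ω n) * ψ n)
    (hH'sa : ∀ x ω, (∀ n, ω n ∈ S) → IsSelfAdjoint (H' x ω))
    {Λ₁ : Set ℝ} (hΛ₁closed : IsClosed Λ₁)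
    (hΛ₁ : ∀ᵐ p ∂(μ.prod ν'), spectrum ℝ (H' p.1 p.2) = Λ₁) {E : ℝ} (hE : E ∉ Λ₁) :
    ∃ δ > 0, ∀ x ω, (∀ n, ω n ∈ S) → ∀ ψ, δ * ‖ψ‖ ≤ ‖H' x ω ψ - E • ψ‖ := by
  obtain ⟨δ, hδ, hball⟩ := Metric.isOpen_iff.1 hΛ₁closed.isOpen_compl E hE
  refine ⟨δ, hδ, fun x ω hω ψ => ?_⟩
  have hgood : ∀ᵐ p ∂(μ.prod ν'), spectrum ℝ (H' p.1 p.2) = Λ₁ ∧ ∀ n, p.2 n ∈ S :=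
    hΛ₁.and (Measure.quasiMeasurePreserving_snd.ae
      (ae_forall_mem_of_product hS hScompact.isClosed hν'))
  choose y hy hnear using fun j : ℕ => exists_mem_near_of_ae T hfull f hS hν' hgood x hω
    (Finset.Icc (-(j : ℤ)) j) (η := 1 / ((j : ℝ) + 1)) (by positivity)
  obtain ⟨C, hC⟩ := hScompact.isBounded.exists_norm_le
  have hlim : Tendsto (fun j => H' (y j).1 (y j).2 ψ) atTop (𝓝 (H' x ω ψ)) := by
    refine tendsto_apply_of_diagonal (C := 2 * ‖f‖ + 2 * C)
      (c := fun j k => (f ((T.toEquiv ^ k) (y j).1) - f ((T.toEquiv ^ k) x))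
        + ((y j).2 k - ω k)) (fun j k => ?_) (fun j k => ?_) (fun k => ?_)
    · rw [hH' _ _ (hy j).2, hH' _ _ hω]; ring
    · have h1 := f.norm_coe_le_norm ((T.toEquiv ^ k) (y j).1)
      have h2 := f.norm_coe_le_norm ((T.toEquiv ^ k) x)
      have h3 := hC _ ((hy j).2 k)
      have h4 := hC _ (hω k)
      rw [Real.norm_eq_abs] at h1 h2 h3 h4
      refine (abs_add_le _ _).trans ?_
      refine add_le_add ((abs_sub _ _).trans (by linarith)) ((abs_sub _ _).trans (by linarith))
    · have h0 : Tendsto (fun j : ℕ => 2 * (1 / ((j : ℝ) + 1))) atTop (𝓝 0) := by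
        simpa using (tendsto_one_div_add_atTop_nhds_zero_nat (𝕜 := ℝ)).const_mul 2
      refine squeeze_zero_norm' ?_ h0
      filter_upwards [eventually_ge_atTop k.natAbs] with j hj
      have hk := hnear j k (Finset.mem_Icc.2 ⟨by omega, by omega⟩)
      rw [Real.norm_eq_abs]
      refine (abs_add_le _ _).trans ?_
      linarith [hk.1, hk.2]
  refine ge_of_tendsto' ((hlim.sub_const (E • ψ)).norm) fun j => ?_
  refine le_norm_sub_smul_of_spectrum (hH'sa _ _ (hy j).2) hδ.le (fun z hz hmem => ?_) ψ
  rw [(hy j).1] at hmem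
  exact hball (by rwa [Metric.mem_ball, Real.dist_eq]) hmem

/-- If the hull `X` is connected, then an energy `E` lies outside the almost
sure spectrum `Σ₁` of the randomly perturbed ergodic Schrödinger operator if and only if
either `E - S` is contained in a gap of `Σ₀`, or `Σ₀` is contained in a gap of `E - S`. -/
theorem not_mem_perturbed_spectrum_iff_gap
    {X : Type*} [MetricSpace X] [CompactSpace X] [Nonempty X] [ConnectedSpace X]
    [MeasurableSpace X] [BorelSpace X]
    -- `T` is a homeomorphism of `X`
    (T : X ≃ₜ X)
    -- `μ` is an ergodic Borel probability measure with full topological support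
    (μ : Measure X) [IsProbabilityMeasure μ]
    (hT : Ergodic T μ)
    (hfull : ∀ U : Set X, IsOpen U → U.Nonempty → μ U ≠ 0)
    -- the continuous sampling function
    (f : C(X, ℝ))
    -- the unperturbed Schrödinger operators `H_x` on `ℓ²(ℤ)`
    (H : X → (lp (fun _ : ℤ => ℝ) 2 →L[ℝ] lp (fun _ : ℤ => ℝ) 2))
    (hH : ∀ (x : X) (ψ : lp (fun _ : ℤ => ℝ) 2) (n : ℤ),
      (H x ψ) n = ψ (n + 1) + ψ (n - 1) + f ((T.toEquiv ^ n) x) * ψ n)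
    (hHsa : ∀ x, IsSelfAdjoint (H x))
    -- the unperturbed almost sure spectrum `Λ₀`
    (Λ₀ : Set ℝ) (hΛ₀compact : IsCompact Λ₀)
    (hΛ₀ : ∀ᵐ x ∂μ, spectrum ℝ (H x) = Λ₀)
    -- the single-site measure `ν` with compact support `S` containing at least two points
    (ν : Measure ℝ) [IsProbabilityMeasure ν]
    (S : Set ℝ) (hS : S = {v : ℝ | ∀ U ∈ 𝓝 v, ν U ≠ 0})
    (hScompact : IsCompact S) (hStwo : S.Nontrivial)
    -- `ν'` is the product measure `ν^ℤ` on `ℝ^ℤ`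
    (ν' : Measure (ℤ → ℝ)) [IsProbabilityMeasure ν']
    (hν' : ∀ (F : Finset ℤ) (t : ℤ → Set ℝ), (∀ i, MeasurableSet (t i)) →
      ν' {ω | ∀ i ∈ F, ω i ∈ t i} = ∏ i ∈ F, ν (t i))
    -- the perturbed Schrödinger operators `H_{x,ω}` on `ℓ²(ℤ)`
    (H' : X → (ℤ → ℝ) → (lp (fun _ : ℤ => ℝ) 2 →L[ℝ] lp (fun _ : ℤ => ℝ) 2))
    (hH' : ∀ (x : X) (ω : ℤ → ℝ), (∀ n, ω n ∈ S) →
      ∀ (ψ : lp (fun _ : ℤ => ℝ) 2) (n : ℤ),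
        (H' x ω ψ) n = ψ (n + 1) + ψ (n - 1) + (f ((T.toEquiv ^ n) x) + ω n) * ψ n)
    (hH'sa : ∀ x ω, (∀ n, ω n ∈ S) → IsSelfAdjoint (H' x ω))
    -- the perturbed almost sure spectrum `Λ₁`
    (Λ₁ : Set ℝ) (hΛ₁compact : IsCompact Λ₁)
    (hΛ₁ : ∀ᵐ p ∂(μ.prod ν'), spectrum ℝ (H' p.1 p.2) = Λ₁) :
    ∀ E : ℝ, E ∉ Λ₁ ↔
      (ContainedInGap Λ₀ ((fun s => E - s) '' S) ∨ ContainedInGap ((fun s => E - s) '' S) Λ₀) := by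
  intro E
  have hSne : S.Nonempty := hStwo.nonempty
  set A : Set ℝ := (fun s => E - s) '' S with hA
  have hAcompact : IsCompact A := hScompact.image (by fun_prop)
  have hAne : A.Nonempty := hSne.image _
  obtain ⟨x₀, hx₀⟩ := hΛ₀.exists
  have hΛ₀ne : Λ₀.Nonempty := by
    rw [← hx₀]; exact spectrum_nonempty_of_isSelfAdjoint (hHsa x₀)
  constructor
  · intro hE
    obtain ⟨δ, hδ, hbound⟩ := exists_uniform_lower_bound T hfull f hS hScompact hν' hH' hH'sa
      hΛ₁compact.isClosed hΛ₁ hE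
    have hconst : ∀ v ∈ S, ∀ ψ, δ * ‖ψ‖ ≤ ‖H x₀ ψ - (E - v) • ψ‖ := by
      intro v hv ψ
      have h1 := hbound x₀ (fun _ => v) (fun _ => hv) ψ
      convert h1 using 2
      ext k
      have e1 : (H x₀ ψ - (E - v) • ψ) k = (H x₀ ψ) k - (E - v) * ψ k := rfl
      have e2 : (H' x₀ (fun _ => v) ψ - E • ψ) k = (H' x₀ (fun _ => v) ψ) k - E * ψ k := rfl
      rw [e1, e2, hH, hH' _ _ (fun _ => hv)]
      ring
    by_contra! hgap
    have hdisj : Disjoint A Λ₀ := by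
      rw [Set.disjoint_left]
      rintro _ ⟨v, hv, rfl⟩
      rw [← hx₀]
      exact notMem_spectrum_of_le_norm (hHsa x₀) hδ (hconst v hv)
    obtain ⟨_, ⟨s₁, hs₁, rfl⟩, _, ⟨s₂, hs₂, rfl⟩, b, hb, b', hb', h1, h2, h3⟩ :=
      exists_interlacing hdisj hAne hΛ₀ne hgap.1 hgap.2
    simp only at h1 h2 h3
    have hstep : ∀ n k : ℤ, (if k < n then s₂ else s₁) ∈ S := fun n k => by
      split_ifs <;> assumption
    set K : X → ℤ → EllTwo →L[ℝ] EllTwo := fun x n =>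
      H' x (fun k => if k < n then s₂ else s₁) - algebraMap ℝ (EllTwo →L[ℝ] EllTwo) E with hKdef
    have hKapp : ∀ x n ψ, K x n ψ = H' x (fun k => if k < n then s₂ else s₁) ψ - E • ψ :=
      fun x n ψ => sub_algebraMap_apply_s2 _ _ _
    have hK : ∀ x n ψ k, (K x n ψ) k = ψ (k + 1) + ψ (k - 1)
        + (f ((T.toEquiv ^ k) x) + if k < n then s₂ else s₁) * ψ k - E * ψ k := by
      intro x n ψ k
      rw [← hH' x _ (hstep n) ψ k, hKapp]
      rfl
    have hKδ : ∀ x n ψ, δ * ‖ψ‖ ≤ ‖K x n ψ‖ := fun x n ψ => by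
      rw [hKapp]; exact hbound _ _ (hstep n) ψ
    have hKu : ∀ x n, IsUnit (K x n) := fun x n =>
      isUnit_sub_algebraMap_of_le_norm (hH'sa _ _ (hstep n)) hδ (hbound _ _ (hstep n))
    obtain ⟨s, hs0, hs⟩ := exists_sign_of_green_increments T f (by linarith : s₂ < s₁).ne' hδ
      hK hKδ hKu
    have hsol : ∀ n, ∃ u, K x₀ n u = EllTwo.basisVec n := fun n => by
      obtain ⟨U, hU⟩ := hKu x₀ n
      refine ⟨(↑U⁻¹ : EllTwo →L[ℝ] EllTwo) (EllTwo.basisVec n), ?_⟩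
      rw [← hU]
      exact congrArg (fun B : EllTwo →L[ℝ] EllTwo => B (EllTwo.basisVec n)) U.mul_inv
    choose u hu using hsol
    have hform := form_nonneg_of_increments_nonneg
      (A := H x₀ - algebraMap ℝ (EllTwo →L[ℝ] EllTwo) (E - s₁)) (K := K x₀) (t := s₂ - s₁)
      (s := s) (by linarith : s₂ - s₁ < 0).ne hδ (isSelfAdjoint_sub_algebraMap (hHsa x₀) _)
      (isUnit_sub_algebraMap_of_le_norm (hHsa x₀) hδ (hconst s₁ hs₁))
      (fun n ψ k => by
        rw [hK, sub_algebraMap_apply_s2]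
        have e1 : (H x₀ ψ - (E - s₁) • ψ) k = (H x₀ ψ) k - (E - s₁) * ψ k := rfl
        rw [e1, hH]
        split_ifs <;> ring)
      (hKδ x₀) (hKu x₀) u hu (fun n => hs x₀ n _ (hu n))
    simp only [sub_algebraMap_apply_s2] at hform
    have hspec : ∀ z ∈ Λ₀, 0 ≤ s * ((z - (E - s₁)) * ((E - s₂) - z)) := by
      intro z hz
      rw [← hx₀] at hz
      have h4 := mul_nonneg_of_mem_spectrum (hHsa x₀) hform hz
      have h5 : s * ((z - (E - s₁)) * ((E - s₂) - z)) =
          (s₁ - s₂) * (s * (z - (E - s₁) + (s₂ - s₁)⁻¹ * (z - (E - s₁)) ^ 2)) := by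
        have : s₂ - s₁ ≠ 0 := (by linarith : s₂ - s₁ < 0).ne
        field_simp
        ring
      rw [h5]
      exact mul_nonneg (by linarith) h4
    have hin : 0 < (b - (E - s₁)) * ((E - s₂) - b) := mul_pos (by linarith) (by linarith)
    have hout : (b' - (E - s₁)) * ((E - s₂) - b') < 0 := by
      rcases h3 with h3 | h3
      · exact mul_neg_of_neg_of_pos (by linarith) (by linarith)
      · exact mul_neg_of_pos_of_neg (by linarith) (by linarith)
    have h6 : 0 ≤ s := nonneg_of_mul_nonneg_left (hspec b hb) hin
    have h7 : s ≤ 0 := by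
      by_contra! hpos
      exact absurd (hspec b' hb') (not_le.2 (mul_neg_of_pos_of_neg hpos hout))
    exact hs0 (le_antisymm h7 h6)
  · intro hgap
    obtain ⟨⟨x, ω⟩, ⟨hΛ₁p, hΛ₀p⟩, hω⟩ := ((hΛ₁.and (Measure.quasiMeasurePreserving_fst.ae hΛ₀)).and
      (Measure.quasiMeasurePreserving_snd.ae
        (ae_forall_mem_of_product hS hScompact.isClosed hν'))).exists
    simp only at hΛ₁p hΛ₀p hω
    rw [← hΛ₁p]
    -- `H' x ω - E` is the sum of `H x - c` and the multiplication operator by `c - (E - ω)`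
    have hdecomp : ∀ (c : ℝ) (ψ : EllTwo), ∃ w : EllTwo,
        H' x ω ψ - E • ψ = (H x ψ - c • ψ) + w ∧ ∀ k, w k = (c - (E - ω k)) * ψ k := by
      intro c ψ
      refine ⟨(H' x ω ψ - E • ψ) - (H x ψ - c • ψ), by abel, fun k => ?_⟩
      have e1 : ((H' x ω ψ - E • ψ) - (H x ψ - c • ψ)) k =
        ((H' x ω ψ) k - E * ψ k) - ((H x ψ) k - c * ψ k) := rfl
      rw [e1, hH, hH' _ _ hω]
      ring
    have hωA : ∀ k, E - ω k ∈ A := fun k => ⟨ω k, hω k, rfl⟩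
    rcases hgap with hgap | hgap
    · obtain ⟨p, q, ε, hε, hpq, hsub, hout⟩ :=
        exists_hull_of_containedInGap hΛ₀compact.isClosed hAcompact hAne hgap
      refine notMem_spectrum_of_le_norm (hH'sa x ω hω) hε fun ψ => ?_
      obtain ⟨w, hw, hwk⟩ := hdecomp ((p + q) / 2) ψ
      have h1 : ((q - p) / 2 + ε) * ‖ψ‖ ≤ ‖H x ψ - ((p + q) / 2) • ψ‖ := by
        refine le_norm_sub_smul_of_spectrum (hHsa x) (by linarith) (fun z hz => ?_) ψ
        rw [hΛ₀p]
        rw [abs_lt] at hz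
        exact hout z (by linarith) (by linarith)
      have h2 : ‖w‖ ≤ (q - p) / 2 * ‖ψ‖ := by
        have h3 : ‖w‖ ≤ ‖((q - p) / 2) • ψ‖ := by
          refine EllTwo.norm_le_of_forall_abs_le fun k => ?_
          have e1 : (((q - p) / 2) • ψ) k = (q - p) / 2 * ψ k := rfl
          have h4 := hsub (hωA k)
          rw [hwk, e1, abs_mul, abs_mul]
          refine mul_le_mul_of_nonneg_right ?_ (abs_nonneg _)
          refine le_trans (abs_le.2 ⟨?_, ?_⟩) (le_abs_self _) <;> linarith [h4.1, h4.2]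
        rwa [norm_smul, Real.norm_of_nonneg (by linarith)] at h3
      rw [hw]
      have h5 := norm_sub_le (H x ψ - ((p + q) / 2) • ψ + w) w
      rw [add_sub_cancel_right] at h5
      linarith
    · obtain ⟨p, q, ε, hε, hpq, hsub, hout⟩ :=
        exists_hull_of_containedInGap hAcompact.isClosed hΛ₀compact hΛ₀ne hgap
      refine notMem_spectrum_of_le_norm (hH'sa x ω hω) hε fun ψ => ?_
      obtain ⟨w, hw, hwk⟩ := hdecomp ((p + q) / 2) ψ
      have h1 : ‖H x ψ - ((p + q) / 2) • ψ‖ ≤ (q - p) / 2 * ‖ψ‖ := by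
        refine norm_sub_smul_le_of_spectrum (hHsa x) (fun z hz => ?_) (by linarith) ψ
        rw [hΛ₀p] at hz
        have h4 := hsub hz
        rw [abs_le]
        constructor <;> linarith [h4.1, h4.2]
      have h2 : ((q - p) / 2 + ε) * ‖ψ‖ ≤ ‖w‖ := by
        have h3 : ‖((q - p) / 2 + ε) • ψ‖ ≤ ‖w‖ := by
          refine EllTwo.norm_le_of_forall_abs_le fun k => ?_
          have e1 : (((q - p) / 2 + ε) • ψ) k = ((q - p) / 2 + ε) * ψ k := rfl
          rw [hwk, e1, abs_mul, abs_mul]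
          refine mul_le_mul_of_nonneg_right ?_ (abs_nonneg _)
          rw [abs_of_nonneg (by linarith)]
          by_contra! hlt
          rw [abs_lt] at hlt
          exact hout (E - ω k) (by linarith) (by linarith) (hωA k)
        rwa [norm_smul, Real.norm_of_nonneg (by linarith)] at h3
      rw [hw]
      have h5 := norm_sub_le (H x ψ - ((p + q) / 2) • ψ + w) (H x ψ - ((p + q) / 2) • ψ)
      rw [add_sub_cancel_left] at h5
      linarith
end
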